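/- Let G be a vertex-minimal triangle-free, fork-free graph with chromatic number at least 4, let C be a good 5-cycle in G, let u1 be a vertex at distance exactly 2 from C, let v be a vertex of C, and let a1, b1 be distinct common neighbors of u1 and v. Then neither a1 nor b1 has a neighbor on C other than v. -/

import Mathlib

open SimpleGraph

/-- The fork: `K_{1,4}` with two edges subdivided. Vertex 0 is the center,
adjacent to leaves 1, 2 and to 3, 5; paths 0-3-4 and 0-5-6. -/
def fork : SimpleGraph (Fin 7) :=
  SimpleGraph.fromEdgeSet {s(0, 1), s(0, 2), s(0, 3), s(0, 5), s(3, 4), s(5, 6)}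

/-- A graph is fork-free if it has no induced subgraph isomorphic to the fork. -/
def ForkFree {V : Type} (G : SimpleGraph V) : Prop :=
  IsEmpty (fork ↪g G)

/-- `G` is a vertex-minimal triangle-free, fork-free graph with chromatic
number at least 4: every smaller triangle-free fork-free graph is 3-colorable. -/
def MinCex {V : Type} [Fintype V] (G : SimpleGraph V) : Prop :=
  G.CliqueFree 3 ∧ ForkFree G ∧ 4 ≤ G.chromaticNumber ∧
    ∀ (W : Type) [Fintype W] (H : SimpleGraph W),
      Fintype.card W < Fintype.card V → H.CliqueFree 3 → ForkFree H →
        H.chromaticNumber ≤ 3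

/-- `c` describes a 5-cycle in `G`. -/
def IsC5 {V : Type} (G : SimpleGraph V) (c : Fin 5 → V) : Prop :=
  Function.Injective c ∧ ∀ i : Fin 5, G.Adj (c i) (c (i + 1))

/-- Distance from a vertex `u` to the 5-cycle `c`. -/
noncomputable def distC {V : Type} (G : SimpleGraph V) (c : Fin 5 → V) (u : V) : ℕ :=
  Finset.univ.inf' Finset.univ_nonempty fun i => G.dist u (c i)

/-- A good 5-cycle: one minimizing the number of vertices at distance at least 2. -/
def GoodC5 {V : Type} (G : SimpleGraph V) (c : Fin 5 → V) : Prop :=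
  IsC5 G c ∧ ∀ d : Fin 5 → V, IsC5 G d →
    {u : V | 2 ≤ distC G c u}.ncard ≤ {u : V | 2 ≤ distC G d u}.ncard


/-! ### A certificate checker -/

/-- bit `i` of the mask `m` -/
def tb (m i : ℕ) : Bool := Nat.beq (Nat.land (Nat.shiftRight m i) 1) 1

/-- adjacency of the known vertices `i`, `j` -/
def adjB (A i j : ℕ) : Bool :=
  cond (Nat.ble i j) (tb A (Nat.add (Nat.mul 32 j) i)) (tb A (Nat.add (Nat.mul 32 i) j))

/-- add a new vertex `n` with neighbourhood mask `s` -/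
def addv (A n s : ℕ) : ℕ := Nat.lor A (Nat.shiftLeft s (Nat.mul 32 n))

def maskOf : List ℕ → ℕ
  | [] => 0
  | i :: l => Nat.lor (Nat.shiftLeft 1 i) (maskOf l)

def meets (s t : ℕ) : Bool := !(Nat.beq (Nat.land s t) 0)

def isFork (A c l1 l2 p p2 q q2 : ℕ) : Bool :=
  adjB A c l1 && adjB A c l2 && adjB A c p && adjB A c q && adjB A p p2 && adjB A q q2 &&
  !(Nat.beq l1 l2) && !(adjB A l1 l2) && !(adjB A l1 p) && !(adjB A l1 p2) && !(adjB A l1 q) &&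
  !(adjB A l1 q2) && !(adjB A l2 p) && !(adjB A l2 p2) && !(adjB A l2 q) && !(adjB A l2 q2) &&
  !(adjB A c p2) && !(adjB A c q2) && !(adjB A p q) && !(adjB A p q2) && !(adjB A p2 q) &&
  !(adjB A p2 q2)

/-- mask of those fork-neighbours of `z` in the pattern, which are below `n` -/
def nbMask (n z c l1 l2 p p2 q q2 : ℕ) : ℕ :=
  maskOf (List.filter (fun i => Nat.blt i n)
    (cond (Nat.beq z c) [l1, l2, p, q] (cond (Nat.beq z p) [c, p2] (cond (Nat.beq z q) [c, q2]
      (cond (Nat.beq z p2) [p] (cond (Nat.beq z q2) [q]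
        (cond (Nat.beq z l1) [c] (cond (Nat.beq z l2) [c] []))))))))

/-- mask of the known vertices of a pattern -/
def knMask (n c l1 l2 p p2 q q2 : ℕ) : ℕ :=
  maskOf (List.filter (fun i => Nat.blt i n) [c, l1, l2, p, p2, q, q2])

def allLe (n c l1 l2 p p2 q q2 : ℕ) : Bool :=
  Nat.ble c n && Nat.ble l1 n && Nat.ble l2 n && Nat.ble p n && Nat.ble p2 n && Nat.ble q n &&
    Nat.ble q2 n

def forkOK (n A P c l1 l2 p p2 q q2 : ℕ) : Bool :=
  allLe n c l1 l2 p p2 q q2 && isFork (addv A n P) c l1 l2 p p2 q q2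

/-- homomorphism move -/
def phi (x1 y1 x2 y2 i : ℕ) : ℕ := cond (Nat.beq i x1) y1 (cond (Nat.beq i x2) y2 i)

def homOK (n A : ℕ) (T : List ℕ) (x1 y1 x2 y2 : ℕ) : Bool :=
  Nat.blt x1 n && Nat.blt y1 n && Nat.blt x2 n && Nat.blt y2 n && !(Nat.beq y1 x1) &&
  !(Nat.beq y2 x1) &&
  List.all (List.range n) (fun i =>
    (!(adjB A x1 i) || adjB A y1 (phi x1 y1 x2 y2 i)) &&
    (!(adjB A x2 i) || adjB A (phi x1 y1 x2 y2 x2) (phi x1 y1 x2 y2 i))) &&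
  List.all T (fun t => (!(tb t x1) || tb t y1) && (!(tb t x2) || tb t (phi x1 y1 x2 y2 x2)))

def okc (A v c : ℕ) : List (ℕ × ℕ) → Bool
  | [] => true
  | (w, d) :: l => !(Nat.beq c d && adjB A v w) && okc A v c l

def extC (A : ℕ) : List ℕ → List (ℕ × ℕ) → Bool
  | [], _ => true
  | v :: S, asg =>
    (okc A v 0 asg && extC A S ((v, 0) :: asg)) || ((okc A v 1 asg && extC A S ((v, 1) :: asg)) ||
      (okc A v 2 asg && extC A S ((v, 2) :: asg)))

def allC (A : ℕ) (S : List ℕ) : List ℕ → List (ℕ × ℕ) → Bool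
  | [], asg => extC A S asg
  | v :: R, asg =>
    (!(okc A v 0 asg) || allC A S R ((v, 0) :: asg)) &&
      ((!(okc A v 1 asg) || allC A S R ((v, 1) :: asg)) &&
        (!(okc A v 2 asg) || allC A S R ((v, 2) :: asg)))

def colOK (n A : ℕ) (T S : List ℕ) : Bool :=
  List.any S (fun _ => true) && List.all S (fun i => Nat.blt i n) &&
  List.all T (fun t => !(meets t (maskOf S))) &&
  allC A S (List.filter (fun i => !(tb (maskOf S) i) && List.any S (fun s => adjB A s i))
    (List.range n)) []

def domB (A : ℕ) (D : List ℕ) (i : ℕ) : Bool :=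
  List.any D (fun d => Nat.beq i d || adjB A d i)

def goodOK (n A : ℕ) (T : List ℕ) (d0 d1 d2 d3 d4 : ℕ) : Bool :=
  Nat.blt d0 n && Nat.blt d1 n && Nat.blt d2 n && Nat.blt d3 n && Nat.blt d4 n &&
  adjB A d0 d1 && adjB A d1 d2 && adjB A d2 d3 && adjB A d3 d4 && adjB A d4 d0 &&
  Nat.blt
    (List.length (List.filter (fun i => domB A [0, 1, 2, 3, 4] i &&
      !(domB A [d0, d1, d2, d3, d4] i)) (List.range n)))
    (List.length (List.filter (fun i => domB A [d0, d1, d2, d3, d4] i &&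
      !(domB A [0, 1, 2, 3, 4] i)) (List.range n))) &&
  List.all T (fun t => !(meets t 31) || meets t (maskOf [d0, d1, d2, d3, d4]))

/-- a two vertex pattern: mask of known vertices, and the two required traces -/
def killsP (s t : ℕ) (m : ℕ × ℕ × ℕ) : Bool :=
  Nat.beq (Nat.land s m.1) m.2.1 && Nat.beq (Nat.land t m.1) m.2.2

def fork2OK (n A P1 P2 c l1 l2 p p2 q q2 : ℕ) : Bool :=
  allLe (Nat.succ n) c l1 l2 p p2 q q2 &&
    isFork (addv (addv A n P1) (Nat.succ n) (Nat.lor P2 (Nat.shiftLeft 1 n))) c l1 l2 p p2 q q2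

/-- read `k` two vertex patterns -/
def readPats (n A : ℕ) : ℕ → List ℕ → List (ℕ × ℕ × ℕ) → Option (List (ℕ × ℕ × ℕ) × List ℕ)
  | 0, l, acc => some (acc, l)
  | k + 1, c :: l1 :: l2 :: p :: p2 :: q :: q2 :: l, acc =>
    cond (fork2OK n A (nbMask n n c l1 l2 p p2 q q2) (nbMask n (Nat.succ n) c l1 l2 p p2 q q2)
        c l1 l2 p p2 q q2)
      (readPats n A k l ((knMask n c l1 l2 p p2 q q2, nbMask n n c l1 l2 p p2 q q2,
        nbMask n (Nat.succ n) c l1 l2 p p2 q q2) :: acc)) none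
  | _ + 1, _, _ => none

/-- read `k` tokens -/
def readN : ℕ → List ℕ → List ℕ × List ℕ
  | 0, l => ([], l)
  | _ + 1, [] => ([], [])
  | k + 1, a :: l => (a :: (readN k l).1, (readN k l).2)

def nth (l : List ℕ) (i : ℕ) : ℕ := l.getD i 0

def pairOK (pats : List (ℕ × ℕ × ℕ)) (x y : ℕ × ℕ) : Bool :=
  (Nat.blt x.2 3 && Nat.blt y.2 3 && !(Nat.beq x.2 y.2)) || ((Nat.beq x.2 3 && Nat.beq y.2 3) ||
    (meets x.1 y.1 || List.any pats (fun m => killsP x.1 y.1 m || killsP y.1 x.1 m)))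

def tcolOK (n A b : ℕ) (T gc tc : List ℕ) (pats : List (ℕ × ℕ × ℕ)) : Bool :=
  Nat.blt b n && Nat.blt 1 n && Nat.beq (List.length T) (List.length tc) &&
  List.all (List.range n) (fun i => Nat.blt (nth gc i) 3 &&
    List.all (List.range n) (fun j => !(adjB A i j) || !(Nat.beq (nth gc i) (nth gc j)))) &&
  List.all (List.zip T tc) (fun x => Nat.ble x.2 3 &&
    List.all (List.range n) (fun i => !(tb x.1 i) ||
      cond (Nat.beq x.2 3) (Nat.beq i b) (!(Nat.beq x.2 (nth gc i))))) &&
  List.all (List.zip T tc) (fun x => List.all (List.zip T tc) (fun y => pairOK pats x y))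

def tcolRun (n A b : ℕ) (T : List ℕ) (l : List ℕ) : Option (List ℕ) :=
  match readN n l with
  | (_, []) => none
  | (gc, k :: l) =>
    match readPats n A k l [] with
    | none => none
    | some (pats, l) =>
      cond (tcolOK n A b T gc (readN (List.length T) l).1 pats)
        (some (readN (List.length T) l).2) none

def childT (n s : ℕ) (T : List ℕ) : List ℕ :=
  List.append T (List.map (fun t => Nat.lor t (Nat.shiftLeft 1 n))
    (List.filter (fun t => !(meets t s)) T))

/-- The checker: `run fuel n A T l` reads a refutation of the state `(n, A, T)` from `l` and
returns the remaining tokens. -/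
def run : ℕ → ℕ → ℕ → List ℕ → List ℕ → Option (List ℕ)
  | 0, _, _, _, _ => none
  | _ + 1, _, _, _, [] => none
  | k + 1, n, A, T, op :: l =>
    cond (Nat.beq op 0)
      (match l with
        | c :: l1 :: l2 :: p :: p2 :: q :: q2 :: l =>
          cond (forkOK n A (nbMask n n c l1 l2 p p2 q q2) c l1 l2 p p2 q q2)
            (run k n A (List.filter (fun t => !(Nat.beq (Nat.land t (knMask n c l1 l2 p p2 q q2))
              (nbMask n n c l1 l2 p p2 q q2))) T) l) none
        | _ => none)
    (cond (Nat.beq op 1)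
      (match l with
        | i :: l =>
          cond (Nat.blt n 31)
            (match run k (Nat.succ n) (addv A n (nth T i)) (childT n (nth T i) T) l with
              | none => none
              | some l' => run k n A (List.filter (fun t => !(Nat.beq t (nth T i))) T) l') none
        | _ => none)
    (cond (Nat.beq op 2)
      (match l with
        | x1 :: y1 :: x2 :: y2 :: l => cond (homOK n A T x1 y1 x2 y2) (some l) none
        | _ => none)
    (cond (Nat.beq op 3)
      (match l with
        | m :: l => cond (colOK n A T (readN m l).1) (some (readN m l).2) none
        | _ => none)
    (cond (Nat.beq op 4)
      (match l with
        | d0 :: d1 :: d2 :: d3 :: d4 :: l => cond (goodOK n A T d0 d1 d2 d3 d4) (some l) none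
        | _ => none)
      (match l with
        | b :: l => tcolRun n A b T l
        | _ => none)))))

/-- decode base 128 chunks of length 40 -/
def dec1 : ℕ → ℕ → List ℕ → List ℕ
  | 0, _, r => r
  | k + 1, x, r => Nat.mod x 128 :: dec1 k (Nat.div x 128) r

def dec : List ℕ → List ℕ
  | [] => []
  | x :: l => dec1 40 x (dec l)

def mkA : List (ℕ × ℕ) → ℕ
  | [] => 0
  | (i, j) :: l => Nat.lor (Nat.shiftLeft 1 (Nat.add (Nat.mul 32 j) i)) (mkA l)

def T0 (A : ℕ) : List ℕ :=
  List.filter (fun t => List.all (List.range 8) (fun i => List.all (List.range 8) (fun j =>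
    !(tb t i && tb t j && adjB A i j)))) (List.range 256)

def baseE : List (ℕ × ℕ) :=
  [(0, 1), (1, 2), (2, 3), (3, 4), (0, 4), (0, 6), (0, 7), (5, 6), (5, 7), (2, 6)]

def runs (E : List (ℕ × ℕ)) (l : List ℕ) : Bool :=
  Option.isSome (run 4000 8 (mkA E) (T0 (mkA E)) (dec l))

section


/-! ### Soundness: bit lemmas -/

theorem nbeq {a b : ℕ} : Nat.beq a b = true ↔ a = b := by
  rw [Nat.beq_eq]

theorem one_bit (i : ℕ) : Nat.testBit 1 i = decide (i = 0) := by
  cases i with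
  | zero => rfl
  | succ k => simp [Nat.testBit_succ]

theorem tb_eq (m i : ℕ) : tb m i = m.testBit i := by
  unfold tb
  show Nat.beq ((m >>> i) &&& 1) 1 = _
  rw [Nat.testBit_eq_decide_div_mod_eq, Nat.and_one_is_mod, Nat.shiftRight_eq_div_pow]
  rw [Bool.eq_iff_iff]; simp

theorem adjB_comm (A i j : ℕ) : adjB A i j = adjB A j i := by
  unfold adjB
  rcases lt_trichotomy i j with h | h | h
  · have h1 : Nat.ble i j = true := by simpa using h.le
    have h2 : Nat.ble j i = false := by
      rw [Bool.eq_false_iff]; simpa using h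
    rw [h1, h2]; rfl
  · rw [h]
  · have h1 : Nat.ble j i = true := by simpa using h.le
    have h2 : Nat.ble i j = false := by
      rw [Bool.eq_false_iff]; simpa using h
    rw [h1, h2]; rfl

theorem adjB_of_le {A i j : ℕ} (h : i ≤ j) : adjB A i j = A.testBit (32 * j + i) := by
  unfold adjB
  have h1 : Nat.ble i j = true := by simpa using h
  rw [h1]
  exact tb_eq _ _

theorem addv_testBit (A n s k : ℕ) :
    (addv A n s).testBit k = (A.testBit k || (decide (32 * n ≤ k) && s.testBit (k - 32 * n))) := by
  unfold addv
  show (A ||| (s <<< (32 * n))).testBit k = _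
  rw [Nat.testBit_or, Nat.testBit_shiftLeft]

theorem adjB_addv_old {A n s i j : ℕ} (hn : n ≤ 32) (hi : i < n) (hj : j < n) :
    adjB (addv A n s) i j = adjB A i j := by
  wlog h : i ≤ j generalizing i j
  · rw [adjB_comm, this hj hi (by omega), adjB_comm]
  rw [adjB_of_le h, adjB_of_le h, addv_testBit]
  have : ¬ (32 * n ≤ 32 * j + i) := by omega
  simp [this]

theorem adjB_addv_new {A n s i : ℕ} (hA : ∀ k, 32 * n ≤ k → A.testBit k = false)
    (hi : i ≤ n) :
    adjB (addv A n s) i n = s.testBit i := by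
  rw [adjB_of_le hi, addv_testBit, hA _ (by omega)]
  simp

theorem addv_bound {A n s : ℕ} (hn : n < 32) (hA : ∀ k, 32 * n ≤ k → A.testBit k = false)
    (hs : ∀ k, n ≤ k → s.testBit k = false) :
    ∀ k, 32 * (n + 1) ≤ k → (addv A n s).testBit k = false := by
  intro k hk
  rw [addv_testBit, hA _ (by omega), hs _ (by omega)]
  simp

theorem maskOf_testBit (l : List ℕ) (i : ℕ) : (maskOf l).testBit i = decide (i ∈ l) := by
  induction l with
  | nil => simp [maskOf]
  | cons a l ih =>
    unfold maskOf
    show ((1 <<< a) ||| maskOf l).testBit i = _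
    rw [Nat.testBit_or, ih, Nat.testBit_shiftLeft, Bool.eq_iff_iff]
    simp only [Bool.or_eq_true, Bool.and_eq_true, decide_eq_true_eq, List.mem_cons, one_bit, decide_eq_true_eq]
    constructor
    · rintro (⟨h1, h2⟩ | h)
      · left; omega
      · right; exact h
    · rintro (h | h)
      · left; subst h; simp
      · right; exact h

theorem meets_iff (s t : ℕ) : meets s t = true ↔ ∃ i, s.testBit i = true ∧ t.testBit i = true := by
  unfold meets
  show (!(Nat.beq (s &&& t) 0)) = true ↔ _
  rw [Bool.not_eq_true', Bool.eq_false_iff, ne_eq, nbeq]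
  constructor
  · intro h
    obtain ⟨i, hi⟩ := Nat.exists_testBit_of_ne_zero h
    exact ⟨i, by simpa [Nat.testBit_and] using hi⟩
  · rintro ⟨i, h1, h2⟩ h
    have : (s &&& t).testBit i = true := by simp [Nat.testBit_and, h1, h2]
    rw [h] at this; simp at this

theorem setBit_testBit (t n i : ℕ) :
    (Nat.lor t (Nat.shiftLeft 1 n)).testBit i = (t.testBit i || decide (i = n)) := by
  show (t ||| (1 <<< n)).testBit i = _
  rw [Nat.testBit_or, Nat.testBit_shiftLeft, Bool.eq_iff_iff]
  simp only [Bool.or_eq_true, Bool.and_eq_true, decide_eq_true_eq, one_bit, decide_eq_true_eq]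
  constructor
  · rintro (h | ⟨h1, h2⟩)
    · left; exact h
    · right; omega
  · rintro (h | h)
    · left; exact h
    · right; subst h; simp

theorem land_trace {t M P i : ℕ} (h : Nat.beq (Nat.land t M) P = true) (hi : M.testBit i = true) :
    t.testBit i = P.testBit i := by
  have h1 : t &&& M = P := by simpa using h
  rw [← h1, Nat.testBit_and, hi, Bool.and_true]

/-! ### Soundness: graph context -/

/-- What we use about the graph. -/
structure Ctx {V : Type} (G : SimpleGraph V) (c : ℕ → V) : Prop where
  fin : Finite V
  tf : ∀ x y z, G.Adj x y → G.Adj y z → G.Adj x z → False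
  fk : ∀ c l1 l2 p p2 q q2, G.Adj c l1 → G.Adj c l2 → G.Adj c p → G.Adj c q → G.Adj p p2 →
    G.Adj q q2 → l1 ≠ l2 → ¬ G.Adj l1 l2 → ¬ G.Adj l1 p → ¬ G.Adj l1 p2 → ¬ G.Adj l1 q →
    ¬ G.Adj l1 q2 → ¬ G.Adj l2 p → ¬ G.Adj l2 p2 → ¬ G.Adj l2 q → ¬ G.Adj l2 q2 →
    ¬ G.Adj c p2 → ¬ G.Adj c q2 → ¬ G.Adj p q → ¬ G.Adj p q2 → ¬ G.Adj p2 q →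
    ¬ G.Adj p2 q2 → False
  sub : ∀ S : Set V, S ≠ Set.univ → ∃ col : V → ℕ, (∀ x, col x < 3) ∧
    ∀ x ∈ S, ∀ y ∈ S, G.Adj x y → col x ≠ col y
  nc : ∀ col : V → ℕ, (∀ x, col x < 3) → (∀ x y, G.Adj x y → col x ≠ col y) → False
  good : ∀ d : ℕ → V, (∀ i, i < 5 → ∀ j, j < 5 → d i = d j → i = j) →
    (∀ i, i < 5 → G.Adj (d i) (d ((i + 1) % 5))) →
    {x | (∃ i < 5, x = d i ∨ G.Adj x (d i)) ∧ ¬ ∃ i < 5, x = c i ∨ G.Adj x (c i)}.ncard ≤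
    {x | (∃ i < 5, x = c i ∨ G.Adj x (c i)) ∧ ¬ ∃ i < 5, x = d i ∨ G.Adj x (d i)}.ncard

/-- The vertex `z` has type `t`. -/
def HasType {V : Type} (G : SimpleGraph V) (f : ℕ → V) (n : ℕ) (z : V) (t : ℕ) : Prop :=
  ∀ i < n, (G.Adj z (f i) ↔ t.testBit i = true)

structure KInv {V : Type} (G : SimpleGraph V) (c f : ℕ → V) (n A : ℕ) (T : List ℕ) : Prop where
  n5 : 5 ≤ n
  n32 : n ≤ 31
  cyc : ∀ i < 5, f i = c i
  inj : ∀ i < n, ∀ j < n, f i = f j → i = j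
  adj : ∀ i < n, ∀ j < n, (G.Adj (f i) (f j) ↔ adjB A i j = true)
  bd : ∀ k, 32 * n ≤ k → A.testBit k = false
  tbd : ∀ t ∈ T, ∀ k, n ≤ k → t.testBit k = false
  ty : ∀ z, (∀ i < n, z ≠ f i) → ∃ t ∈ T, HasType G f n z t

variable {V : Type} {G : SimpleGraph V} {c f : ℕ → V} {n A : ℕ} {T : List ℕ}

theorem isFork_sound (hx : Ctx G c) (g : ℕ → V) {B v0 l1 l2 p p2 q q2 N : ℕ}
    (hle : allLe N v0 l1 l2 p p2 q q2 = true)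
    (hF : isFork B v0 l1 l2 p p2 q q2 = true)
    (hinj : ∀ i ≤ N, ∀ j ≤ N, g i = g j → i = j)
    (hadj : ∀ i, i ∈ [v0, l1, l2, p, p2, q, q2] → ∀ j, j ∈ [v0, l1, l2, p, p2, q, q2] →
      (G.Adj (g i) (g j) ↔ adjB B i j = true)) : False := by
  simp only [allLe, Bool.and_eq_true, Nat.ble_eq] at hle
  simp only [isFork, Bool.and_eq_true, Bool.not_eq_true', Bool.eq_false_iff, ne_eq,
    nbeq] at hF
  obtain ⟨⟨⟨⟨⟨⟨h0, h1⟩, h2⟩, h3⟩, h4⟩, h5⟩, h6⟩ := hle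
  simp only [and_assoc] at hF
  obtain ⟨e1, e2, e3, e4, e5, e6, ne, f1, f2, f3, f4, f5, f6, f7, f8, f9, f10, f11, f12, f13,
    f14, f15⟩ := hF
  apply hx.fk (g v0) (g l1) (g l2) (g p) (g p2) (g q) (g q2) <;>
    first
    | (intro h; exact ne (hinj _ h1 _ h2 h))
    | (rw [hadj _ (by simp) _ (by simp)]; assumption)

/-- the extension of `f` by a new vertex -/
theorem addv_adj (hI : KInv G c f n A T) {z : V} (hz : ∀ i < n, z ≠ f i) {P : ℕ}
    (hP : P.testBit n = false) (i j : ℕ) (hi : i ≤ n) (hj : j ≤ n)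
    (hPi : i < n → (G.Adj z (f i) ↔ P.testBit i = true))
    (hPj : j < n → (G.Adj z (f j) ↔ P.testBit j = true)) :
    G.Adj (Function.update f n z i) (Function.update f n z j) ↔ adjB (addv A n P) i j = true := by
  have hn := hI.n32
  rcases hi.lt_or_eq with hi' | rfl
  · rcases hj.lt_or_eq with hj' | rfl
    · rw [Function.update_of_ne hi'.ne, Function.update_of_ne hj'.ne,
        adjB_addv_old (by omega) hi' hj', hI.adj i hi' j hj']
    · rw [Function.update_of_ne hi'.ne, Function.update_self, adjB_addv_new hI.bd hi, G.adj_comm,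
        hPi hi']
  · rcases hj.lt_or_eq with hj' | rfl
    · rw [Function.update_of_ne hj'.ne, Function.update_self, adjB_comm, adjB_addv_new hI.bd hj,
        hPj hj']
    · rw [adjB_addv_new hI.bd hi, hP]; simp

theorem update_inj (hI : KInv G c f n A T) {z : V} (hz : ∀ i < n, z ≠ f i) :
    ∀ i ≤ n, ∀ j ≤ n, Function.update f n z i = Function.update f n z j → i = j := by
  intro i hi j hj
  rcases hi.lt_or_eq with hi' | rfl
  · rcases hj.lt_or_eq with hj' | rfl
    · rw [Function.update_of_ne hi'.ne, Function.update_of_ne hj'.ne]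
      exact hI.inj i hi' j hj'
    · rw [Function.update_of_ne hi'.ne, Function.update_self]
      intro h; exact absurd h.symm (hz i hi')
  · rcases hj.lt_or_eq with hj' | rfl
    · rw [Function.update_of_ne hj'.ne, Function.update_self]
      intro h; exact absurd h (hz j hj')
    · intro _; rfl

theorem knMask_testBit {v0 l1 l2 p p2 q q2 i : ℕ} (hi : i ∈ [v0, l1, l2, p, p2, q, q2])
    (hn : i < n) : (knMask n v0 l1 l2 p p2 q q2).testBit i = true := by
  unfold knMask
  rw [maskOf_testBit, decide_eq_true_eq, List.mem_filter]
  exact ⟨hi, by simpa using hn⟩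

theorem nbMask_testBit {z v0 l1 l2 p p2 q q2 i : ℕ}
    (hn : n ≤ i) : (nbMask n z v0 l1 l2 p p2 q q2).testBit i = false := by
  unfold nbMask
  rw [maskOf_testBit, decide_eq_false_iff_not, List.mem_filter]
  rintro ⟨-, h⟩
  have : i < n := by simpa using h
  omega

theorem mem_le {v0 l1 l2 p p2 q q2 i : ℕ}
    (hle : allLe n v0 l1 l2 p p2 q q2 = true) (hi : i ∈ [v0, l1, l2, p, p2, q, q2]) : i ≤ n := by
  simp only [allLe, Bool.and_eq_true, Nat.ble_eq] at hle
  simp at hi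
  omega

theorem fork_sound (hx : Ctx G c) (hI : KInv G c f n A T) {v0 l1 l2 p p2 q q2 : ℕ}
    (hF : forkOK n A (nbMask n n v0 l1 l2 p p2 q q2) v0 l1 l2 p p2 q q2 = true) :
    KInv G c f n A (List.filter (fun t => !(Nat.beq (Nat.land t (knMask n v0 l1 l2 p p2 q q2))
              (nbMask n n v0 l1 l2 p p2 q q2))) T) := by
  refine { hI with tbd := ?_, ty := ?_ }
  · intro t ht; exact hI.tbd t (List.mem_filter.1 ht).1
  · intro z hz
    obtain ⟨t, ht, htz⟩ := hI.ty z hz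
    refine ⟨t, List.mem_filter.2 ⟨ht, ?_⟩, htz⟩
    rw [Bool.not_eq_true', Bool.eq_false_iff]
    intro hb
    unfold forkOK at hF
    rw [Bool.and_eq_true] at hF
    refine isFork_sound hx (Function.update f n z) hF.1 hF.2 (update_inj hI hz) ?_
    intro i hi j hj
    refine addv_adj hI hz (nbMask_testBit le_rfl) i j (mem_le hF.1 hi) (mem_le hF.1 hj) ?_ ?_
    · intro h; rw [htz i h, land_trace hb (knMask_testBit hi h)]
    · intro h; rw [htz j h, land_trace hb (knMask_testBit hj h)]

theorem branch_child (hx : Ctx G c) (hI : KInv G c f n A T) (hn : n < 31) {z : V}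
    (hz : ∀ i < n, z ≠ f i) {s : ℕ} (hs : ∀ k, n ≤ k → s.testBit k = false)
    (hzs : HasType G f n z s) :
    KInv G c (Function.update f n z) (n + 1) (addv A n s) (childT n s T) := by
  have hT : ∀ t, t ∈ childT n s T ↔ t ∈ T ∨ ∃ r ∈ T, meets r s = false ∧
      Nat.lor r (Nat.shiftLeft 1 n) = t := by
    intro t
    unfold childT
    show t ∈ T ++ _ ↔ _
    simp only [List.mem_append, List.mem_map, List.mem_filter, Bool.not_eq_true', and_assoc]
  have hup : ∀ i < n, Function.update f n z i = f i := fun i hi => Function.update_of_ne hi.ne _ _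
  refine ⟨by have := hI.n5; omega, by omega, ?_, ?_, ?_, addv_bound (by omega) hI.bd hs, ?_, ?_⟩
  · intro i hi; rw [hup i (by have := hI.n5; omega)]; exact hI.cyc i hi
  · intro i hi j hj; exact update_inj hI hz i (by omega) j (by omega)
  · intro i hi j hj
    exact addv_adj hI hz (hs n le_rfl) i j (by omega) (by omega) (fun h => hzs i h)
      (fun h => hzs j h)
  · intro t ht k hk
    rcases (hT t).1 ht with h | ⟨r, hr, -, rfl⟩
    · exact hI.tbd t h k (by omega)
    · rw [setBit_testBit, hI.tbd r hr k (by omega)]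
      simp; omega
  · intro w hw
    have hw' : ∀ i < n, w ≠ f i := fun i hi => by
      have := hw i (by omega); rwa [hup i hi] at this
    obtain ⟨t, ht, htw⟩ := hI.ty w hw'
    by_cases hwz : G.Adj w z
    · refine ⟨Nat.lor t (Nat.shiftLeft 1 n), (hT _).2 (Or.inr ⟨t, ht, ?_, rfl⟩), ?_⟩
      · rw [Bool.eq_false_iff]
        intro hm
        obtain ⟨i, h1, h2⟩ := (meets_iff _ _).1 hm
        have hi : i < n := by
          by_contra h
          rw [hs i (by omega)] at h2; simp at h2
        exact hx.tf w z (f i) hwz ((hzs i hi).2 h2) ((htw i hi).2 h1)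
      · intro i hi
        rw [setBit_testBit]
        rcases (Nat.lt_succ_iff.1 hi).lt_or_eq with h | rfl
        · rw [hup i h, htw i h]; simp [h.ne]
        · rw [Function.update_self]; simp [hwz]
    · refine ⟨t, (hT _).2 (Or.inl ht), ?_⟩
      intro i hi
      rcases (Nat.lt_succ_iff.1 hi).lt_or_eq with h | rfl
      · rw [hup i h, htw i h]
      · rw [Function.update_self, hI.tbd t ht i le_rfl]; simp [hwz]

theorem branch_rest (hI : KInv G c f n A T) {s : ℕ}
    (h : ∀ z, (∀ i < n, z ≠ f i) → ¬ HasType G f n z s) :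
    KInv G c f n A (List.filter (fun t => !(Nat.beq t s)) T) := by
  refine { hI with tbd := ?_, ty := ?_ }
  · intro t ht; exact hI.tbd t (List.mem_filter.1 ht).1
  · intro z hz
    obtain ⟨t, ht, htz⟩ := hI.ty z hz
    refine ⟨t, List.mem_filter.2 ⟨ht, ?_⟩, htz⟩
    rw [Bool.not_eq_true', Bool.eq_false_iff]
    intro hb
    have : t = s := by simpa using hb
    subst this
    exact h z hz htz


/-! ### Soundness of the closing rules -/

open Classical in
theorem hom_sound (hx : Ctx G c) (hI : KInv G c f n A T) {x1 y1 x2 y2 : ℕ}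
    (hH : homOK n A T x1 y1 x2 y2 = true) : False := by
  simp only [homOK, Bool.and_eq_true, Bool.not_eq_true', Bool.eq_false_iff, ne_eq, nbeq,
    List.all_eq_true, List.mem_range, Bool.or_eq_true, Nat.blt_eq, and_assoc, tb_eq] at hH
  obtain ⟨hx1, hy1, hx2, hy2, n1, n2, hA, hT⟩ := hH
  have p1 : phi x1 y1 x2 y2 x1 = y1 := by
    simp [phi]
  have hphi : ∀ i, i ≠ x1 → i ≠ x2 → phi x1 y1 x2 y2 i = i := by
    intro i h1 h2
    have e1 : Nat.beq i x1 = false := by rw [Bool.eq_false_iff, ne_eq, nbeq]; exact h1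
    have e2 : Nat.beq i x2 = false := by rw [Bool.eq_false_iff, ne_eq, nbeq]; exact h2
    simp [phi, e1, e2]
  have hphi' : ∀ i, phi x1 y1 x2 y2 i ≠ x1 := by
    intro i
    unfold phi
    cases e1 : Nat.beq i x1 with
    | true => exact n1
    | false =>
      cases e2 : Nat.beq i x2 with
      | true => exact n2
      | false =>
        rw [Bool.eq_false_iff, ne_eq, nbeq] at e1
        exact e1
  have hphin : ∀ i < n, phi x1 y1 x2 y2 i < n := by
    intro i hi
    unfold phi
    cases e1 : Nat.beq i x1 with
    | true => exact hy1
    | false =>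
      cases e2 : Nat.beq i x2 with
      | true => exact hy2
      | false => exact hi
  obtain ⟨col, hc3, hcol⟩ := hx.sub {w | w ≠ f x1} (by
    intro h
    have : f x1 ∈ {w | w ≠ f x1} := by rw [h]; trivial
    exact this rfl)
  -- the colour of a vertex
  let F : V → V := fun w => if h : ∃ i < n, w = f i then f (phi x1 y1 x2 y2 (choose h)) else w
  have F1 : ∀ i < n, F (f i) = f (phi x1 y1 x2 y2 i) := by
    intro i hi
    have h : ∃ j < n, f i = f j := ⟨i, hi, rfl⟩
    have : choose h = i := (hI.inj i hi _ (choose_spec h).1 (choose_spec h).2).symm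
    simp only [F, dif_pos h, this]
  have F2 : ∀ w, (∀ i < n, w ≠ f i) → F w = w := by
    intro w hw
    have h : ¬ ∃ j < n, w = f j := by rintro ⟨j, hj, h⟩; exact hw j hj h
    simp only [F, dif_neg h]
  have F3 : ∀ w, F w ≠ f x1 := by
    intro w
    by_cases h : ∃ i < n, w = f i
    · obtain ⟨i, hi, rfl⟩ := h
      rw [F1 i hi]
      intro h
      exact hphi' i (hI.inj _ (hphin i hi) _ hx1 h)
    · rw [F2 w (by rintro i hi h'; exact h ⟨i, hi, h'⟩)]
      rintro rfl; exact h ⟨x1, hx1, rfl⟩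
  have key : ∀ i < n, ∀ w, G.Adj (f i) w → G.Adj (F (f i)) (F w) := by
    intro i hi w hw
    by_cases hwk : ∃ j < n, w = f j
    · obtain ⟨j, hj, rfl⟩ := hwk
      rw [F1 i hi, F1 j hj]
      have hb := (hI.adj i hi j hj).1 hw
      by_cases i1 : i = x1
      · subst i1
        rw [p1, hI.adj _ hy1 _ (hphin j hj)]
        rcases (hA j hj).1 with h | h
        · exact absurd hb h
        · exact h
      by_cases i2 : i = x2
      · subst i2
        rw [hI.adj _ (hphin i hi) _ (hphin j hj)]
        rcases (hA j hj).2 with h | h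
        · exact absurd hb h
        · exact h
      rw [hphi i i1 i2]
      rw [adjB_comm] at hb
      rw [G.adj_comm]
      by_cases j1 : j = x1
      · subst j1
        rw [p1, hI.adj _ hy1 _ hi]
        rcases (hA i hi).1 with h | h
        · exact absurd hb h
        · rwa [hphi i i1 i2] at h
      by_cases j2 : j = x2
      · subst j2
        rw [hI.adj _ (hphin j hj) _ hi]
        rcases (hA i hi).2 with h | h
        · exact absurd hb h
        · rwa [hphi i i1 i2] at h
      rw [hphi j j1 j2]; exact hw.symm
    · have hw' : ∀ j < n, w ≠ f j := by rintro j hj h'; exact hwk ⟨j, hj, h'⟩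
      rw [F1 i hi, F2 w hw', G.adj_comm]
      obtain ⟨t, ht, htw⟩ := hI.ty w hw'
      have hb := (htw i hi).1 hw.symm
      by_cases i1 : i = x1
      · subst i1
        rw [p1, htw _ hy1]
        rcases (hT t ht).1 with h | h
        · exact absurd hb h
        · exact h
      by_cases i2 : i = x2
      · subst i2
        rw [htw _ (hphin i hi)]
        rcases (hT t ht).2 with h | h
        · exact absurd hb h
        · exact h
      rw [hphi i i1 i2]; exact hw.symm
  refine hx.nc (fun w => col (F w)) (fun w => hc3 _) ?_
  intro w w' hww
  refine hcol _ (F3 w) _ (F3 w') ?_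
  by_cases h : ∃ i < n, w = f i
  · obtain ⟨i, hi, rfl⟩ := h
    exact key i hi w' hww
  · by_cases h' : ∃ i < n, w' = f i
    · obtain ⟨i, hi, rfl⟩ := h'
      exact (key i hi w hww.symm).symm
    · rw [F2 w (by rintro j hj h''; exact h ⟨j, hj, h''⟩),
        F2 w' (by rintro j hj h''; exact h' ⟨j, hj, h''⟩)]
      exact hww

theorem okc_iff (A v d : ℕ) (l : List (ℕ × ℕ)) :
    okc A v d l = true ↔ ∀ x ∈ l, adjB A v x.1 = true → d ≠ x.2 := by
  induction l with
  | nil => simp [okc]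
  | cons a l ih =>
    obtain ⟨w, e⟩ := a
    simp only [okc, Bool.and_eq_true, ih, List.forall_mem_cons, Bool.not_eq_true',
      Bool.eq_false_iff, ne_eq, nbeq]
    tauto

/-- a proper partial colouring -/
def ProperL (A : ℕ) (l : List (ℕ × ℕ)) : Prop :=
  (∀ x ∈ l, x.2 < 3) ∧ ∀ x ∈ l, ∀ y ∈ l, adjB A x.1 y.1 = true → x.2 ≠ y.2

theorem ProperL.cons {A v d : ℕ} {l : List (ℕ × ℕ)} (hl : ProperL A l) (hd : d < 3)
    (hA : adjB A v v = false) (h : okc A v d l = true) : ProperL A ((v, d) :: l) := by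
  rw [okc_iff] at h
  refine ⟨?_, ?_⟩
  · intro x hx
    rcases List.mem_cons.1 hx with rfl | hx
    · exact hd
    · exact hl.1 x hx
  · intro x hx y hy hxy
    rcases List.mem_cons.1 hx with rfl | hx
    · rcases List.mem_cons.1 hy with rfl | hy
      · simp [hA] at hxy
      · exact h y hy hxy
    · rcases List.mem_cons.1 hy with rfl | hy
      · rw [adjB_comm] at hxy
        exact (h x hx hxy).symm
      · exact hl.2 x hx y hy hxy

theorem extC_sound (A : ℕ) (S : List ℕ) (hS : ∀ v ∈ S, adjB A v v = false) :
    ∀ l, ProperL A l → extC A S l = true →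
    ∃ l', ProperL A l' ∧ (∀ x ∈ l, x ∈ l') ∧ ∀ v ∈ S, ∃ d, (v, d) ∈ l' := by
  induction S with
  | nil => intro l hl _; exact ⟨l, hl, fun x hx => hx, by simp⟩
  | cons v S ih =>
    intro l hl he
    have hv := hS v (by simp)
    have key : ∀ d, d < 3 → okc A v d l = true ∧ extC A S ((v, d) :: l) = true →
        ∃ l', ProperL A l' ∧ (∀ x ∈ l, x ∈ l') ∧ ∀ w ∈ v :: S, ∃ d, (w, d) ∈ l' := by
      rintro d hd ⟨h1, h2⟩
      obtain ⟨l', a, b, e⟩ := ih (fun w hw => hS w (List.mem_cons_of_mem _ hw)) _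
        (hl.cons hd hv h1) h2
      refine ⟨l', a, fun x hx => b x (List.mem_cons_of_mem _ hx), ?_⟩
      intro w hw
      rcases List.mem_cons.1 hw with rfl | hw
      · exact ⟨d, b _ (by simp)⟩
      · exact e w hw
    simp only [extC, Bool.or_eq_true, Bool.and_eq_true] at he
    rcases he with h | h | h
    · exact key 0 (by omega) h
    · exact key 1 (by omega) h
    · exact key 2 (by omega) h

theorem allC_sound (A : ℕ) (S : List ℕ) (h : ℕ → ℕ) (h3 : ∀ i, h i < 3) (R0 : List ℕ)
    (hp : ∀ v ∈ R0, ∀ w ∈ R0, adjB A v w = true → h v ≠ h w) (R : List ℕ) :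
    ∀ l, (∀ v ∈ R, v ∈ R0) → (∀ v ∈ R, adjB A v v = false) →
    (∀ x ∈ l, x.1 ∈ R0 ∧ x.2 = h x.1) → ProperL A l →
    allC A S R l = true → ∃ l', ProperL A l' ∧ (∀ v ∈ R, (v, h v) ∈ l') ∧ (∀ x ∈ l, x ∈ l') ∧
      extC A S l' = true := by
  induction R with
  | nil => intro l _ _ _ hl he; exact ⟨l, hl, by simp, fun x hx => hx, he⟩
  | cons v R ih =>
    intro l hR hvv hlh hl he
    have hv := hvv v (by simp)
    have hok : okc A v (h v) l = true := by
      rw [okc_iff]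
      intro x hx ha
      rw [(hlh x hx).2]
      exact hp v (hR v (by simp)) x.1 (hlh x hx).1 ha
    have he' : allC A S R ((v, h v) :: l) = true := by
      simp only [allC, Bool.or_eq_true, Bool.and_eq_true, Bool.not_eq_true'] at he
      have : h v = 0 ∨ h v = 1 ∨ h v = 2 := by have := h3 v; omega
      rcases this with e | e | e <;> rw [e] at hok ⊢
      · rcases he.1 with h | h
        · rw [hok] at h; simp at h
        · exact h
      · rcases he.2.1 with h | h
        · rw [hok] at h; simp at h
        · exact h
      · rcases he.2.2 with h | h
        · rw [hok] at h; simp at h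
        · exact h
    obtain ⟨l', a, b, e, e2⟩ := ih ((v, h v) :: l) (fun w hw => hR w (List.mem_cons_of_mem _ hw))
      (fun w hw => hvv w (List.mem_cons_of_mem _ hw)) (by
        intro x hx
        rcases List.mem_cons.1 hx with rfl | hx
        · exact ⟨hR v (by simp), rfl⟩
        · exact hlh x hx) (hl.cons (h3 v) hv hok) he'
    refine ⟨l', a, ?_, fun x hx => e x (List.mem_cons_of_mem _ hx), e2⟩
    intro w hw
    rcases List.mem_cons.1 hw with rfl | hw
    · exact e _ (by simp)
    · exact b w hw

open Classical in
theorem col_sound (hx : Ctx G c) (hI : KInv G c f n A T) {S : List ℕ}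
    (hC : colOK n A T S = true) : False := by
  simp only [colOK, Bool.and_eq_true, Bool.not_eq_true', Bool.eq_false_iff, ne_eq,
    List.all_eq_true, List.any_eq_true, Nat.blt_eq, and_assoc, tb_eq, meets_iff, maskOf_testBit,
    decide_eq_true_eq] at hC
  obtain ⟨⟨s0, hs0, -⟩, hSn, hT, hall⟩ := hC
  have hirr : ∀ i < n, adjB A i i = false := by
    intro i hi
    rw [Bool.eq_false_iff, ne_eq, ← hI.adj i hi i hi]
    exact G.loopless.irrefl _
  obtain ⟨col, hc3, hcol⟩ := hx.sub {w | ∀ i ∈ S, w ≠ f i} (by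
    intro h
    have : f s0 ∈ {w | ∀ i ∈ S, w ≠ f i} := by rw [h]; trivial
    exact this s0 hs0 rfl)
  set R := List.filter (fun i => !(decide (i ∈ S)) && List.any S (fun s => adjB A s i))
    (List.range n) with hR
  have memR : ∀ i, i ∈ R ↔ i < n ∧ i ∉ S ∧ ∃ s ∈ S, adjB A s i = true := by
    intro i
    simp only [hR, List.mem_filter, List.mem_range, Bool.and_eq_true, Bool.not_eq_true',
      decide_eq_false_iff_not, List.any_eq_true]
  have hRS : ∀ i ∈ R, f i ∈ {w | ∀ i ∈ S, w ≠ f i} := by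
    intro i hi s hs h
    have := (memR i).1 hi
    exact this.2.1 (hI.inj i this.1 s (hSn s hs) h ▸ hs)
  obtain ⟨l', hl', hl'R, -, hext⟩ := allC_sound A S (fun i => col (f i)) (fun i => hc3 _) R
    (by
      intro v hv w hw ha
      exact hcol _ (hRS v hv) _ (hRS w hw)
        ((hI.adj v ((memR v).1 hv).1 w ((memR w).1 hw).1).2 ha)) R [] (fun v hv => hv)
    (fun v hv => hirr v ((memR v).1 hv).1) (by simp) ⟨by simp, by simp⟩ hall
  obtain ⟨l2, hl2, hsub, hS2⟩ := extC_sound A S (fun v hv => hirr v (hSn v hv)) l' hl' hext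
  choose! d hd using hS2
  let F : V → ℕ := fun w => if h : ∃ i ∈ S, w = f i then d (choose h) else col w
  have F1 : ∀ i ∈ S, F (f i) = d i := by
    intro i hi
    have h : ∃ j ∈ S, f i = f j := ⟨i, hi, rfl⟩
    have : choose h = i :=
      (hI.inj i (hSn i hi) _ (hSn _ (choose_spec h).1) (choose_spec h).2).symm
    simp only [F, dif_pos h, this]
  have F2 : ∀ w, (∀ i ∈ S, w ≠ f i) → F w = col w := by
    intro w hw
    have h : ¬ ∃ j ∈ S, w = f j := by rintro ⟨j, hj, h⟩; exact hw j hj h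
    simp only [F, dif_neg h]
  have key : ∀ i ∈ S, ∀ w, G.Adj (f i) w → F (f i) ≠ F w := by
    intro i hi w hw
    rw [F1 i hi]
    by_cases hwk : ∃ j < n, w = f j
    · obtain ⟨j, hj, rfl⟩ := hwk
      have ha := (hI.adj i (hSn i hi) j hj).1 hw
      by_cases hjS : j ∈ S
      · rw [F1 j hjS]
        exact hl2.2 _ (hd i hi) _ (hd j hjS) ha
      · have hjR : j ∈ R := (memR j).2 ⟨hj, hjS, i, hi, ha⟩
        rw [F2 _ (hRS j hjR)]
        exact hl2.2 _ (hd i hi) _ (hsub _ (hl'R j hjR)) ha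
    · exfalso
      obtain ⟨t, ht, htw⟩ := hI.ty w (by rintro j hj h'; exact hwk ⟨j, hj, h'⟩)
      exact hT t ht ⟨i, (htw i (hSn i hi)).1 hw.symm, hi⟩
  refine hx.nc F ?_ ?_
  · intro w
    by_cases h : ∃ i ∈ S, w = f i
    · obtain ⟨i, hi, rfl⟩ := h
      rw [F1 i hi]
      exact hl2.1 _ (hd i hi)
    · rw [F2 w (by rintro i hi h'; exact h ⟨i, hi, h'⟩)]
      exact hc3 w
  · intro w w' hww
    by_cases h : ∃ i ∈ S, w = f i
    · obtain ⟨i, hi, rfl⟩ := h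
      exact key i hi w' hww
    · by_cases h' : ∃ i ∈ S, w' = f i
      · obtain ⟨i, hi, rfl⟩ := h'
        exact (key i hi w hww.symm).symm
      · have a1 : ∀ i ∈ S, w ≠ f i := by rintro i hi h''; exact h ⟨i, hi, h''⟩
        have a2 : ∀ i ∈ S, w' ≠ f i := by rintro i hi h''; exact h' ⟨i, hi, h''⟩
        rw [F2 w a1, F2 w' a2]
        exact hcol w a1 w' a2 hww


theorem c5_distinct (hx : Ctx G c) {a b d e g : V} (h1 : G.Adj a b) (h2 : G.Adj b d)
    (h3 : G.Adj d e) (h4 : G.Adj e g) (h5 : G.Adj g a) :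
    a ≠ b ∧ a ≠ d ∧ a ≠ e ∧ a ≠ g ∧ b ≠ d ∧ b ≠ e ∧ b ≠ g ∧ d ≠ e ∧ d ≠ g ∧ e ≠ g := by
  refine ⟨h1.ne, ?_, ?_, h5.ne', h2.ne, ?_, ?_, h3.ne, ?_, h4.ne⟩
  · rintro rfl; exact hx.tf _ _ _ h3 h4 h5.symm
  · rintro rfl; exact hx.tf _ _ _ h1 h2 h3.symm
  · rintro rfl; exact hx.tf _ _ _ h4 h5 h1.symm
  · rintro rfl; exact hx.tf _ _ _ h2 h3 h4.symm
  · rintro rfl; exact hx.tf _ _ _ h5 h1 h2.symm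

theorem domB_iff (hI : KInv G c f n A T) {D : List ℕ} (hD : ∀ d ∈ D, d < n) {i : ℕ} (hi : i < n) :
    domB A D i = true ↔ ∃ d ∈ D, f i = f d ∨ G.Adj (f i) (f d) := by
  simp only [domB, List.any_eq_true, Bool.or_eq_true, nbeq]
  constructor
  · rintro ⟨d, hd, h | h⟩
    · exact ⟨d, hd, Or.inl (by rw [h])⟩
    · exact ⟨d, hd, Or.inr ((hI.adj i hi d (hD d hd)).2 (by rwa [adjB_comm]))⟩
  · rintro ⟨d, hd, h | h⟩
    · exact ⟨d, hd, Or.inl (hI.inj i hi d (hD d hd) h)⟩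
    · exact ⟨d, hd, Or.inr (by rw [adjB_comm]; exact (hI.adj i hi d (hD d hd)).1 h)⟩

theorem good_sound (hx : Ctx G c) (hI : KInv G c f n A T) {d0 d1 d2 d3 d4 : ℕ}
    (hC : goodOK n A T d0 d1 d2 d3 d4 = true) : False := by
  have := hx.fin
  have hn5 := hI.n5
  simp only [goodOK, Bool.and_eq_true, List.all_eq_true, Nat.blt_eq, and_assoc,
    Bool.or_eq_true, Bool.not_eq_true', Bool.eq_false_iff, ne_eq, meets_iff] at hC
  obtain ⟨h0, h1, h2, h3, h4, e0, e1, e2, e3, e4, hlt, hT⟩ := hC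
  have g0 := (hI.adj _ h0 _ h1).2 e0
  have g1 := (hI.adj _ h1 _ h2).2 e1
  have g2 := (hI.adj _ h2 _ h3).2 e2
  have g3 := (hI.adj _ h3 _ h4).2 e3
  have g4 := (hI.adj _ h4 _ h0).2 e4
  obtain ⟨k1, k2, k3, k4, k5, k6, k7, k8, k9, k10⟩ := c5_distinct hx g0 g1 g2 g3 g4
  let D : List ℕ := [d0, d1, d2, d3, d4]
  let d : ℕ → V := fun i => f (D.getD i 0)
  have hDn : ∀ x ∈ D, x < n := by
    intro x hx; simp [D] at hx; omega
  have hCn : ∀ x ∈ [0, 1, 2, 3, 4], x < n := by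
    intro x hx; simp at hx; omega
  have hgood := hx.good d (by
    intro i hi j hj h
    interval_cases i <;> interval_cases j <;> simp [d, D] at h ⊢ <;>
      first | exact absurd h (by assumption) | exact absurd h.symm (by assumption)) (by
    intro i hi
    interval_cases i <;> simp [d, D] <;> assumption)
  have domD : ∀ x, (∃ i < 5, x = d i ∨ G.Adj x (d i)) ↔ ∃ i ∈ D, x = f i ∨ G.Adj x (f i) := by
    intro x
    constructor
    · rintro ⟨i, hi, h⟩
      refine ⟨D.getD i 0, ?_, h⟩
      interval_cases i <;> simp [D]
    · rintro ⟨i, hi, h⟩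
      simp [D] at hi
      rcases hi with rfl | rfl | rfl | rfl | rfl
      · exact ⟨0, by omega, h⟩
      · exact ⟨1, by omega, h⟩
      · exact ⟨2, by omega, h⟩
      · exact ⟨3, by omega, h⟩
      · exact ⟨4, by omega, h⟩
  have domC : ∀ x, (∃ i < 5, x = c i ∨ G.Adj x (c i)) ↔
      ∃ i ∈ [0, 1, 2, 3, 4], x = f i ∨ G.Adj x (f i) := by
    intro x
    constructor
    · rintro ⟨i, hi, h⟩
      refine ⟨i, ?_, by rwa [hI.cyc i hi]⟩
      interval_cases i <;> simp
    · rintro ⟨i, hi, h⟩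
      have hi5 : i < 5 := by simp at hi; omega
      exact ⟨i, hi5, by rwa [hI.cyc i hi5] at h⟩
  simp only [domD, domC] at hgood
  set LC := List.filter (fun i => domB A [0, 1, 2, 3, 4] i && !(domB A [d0, d1, d2, d3, d4] i))
    (List.range n) with hLC
  set LD := List.filter (fun i => domB A [d0, d1, d2, d3, d4] i && !(domB A [0, 1, 2, 3, 4] i))
    (List.range n) with hLD
  have memC : ∀ i, i ∈ LC ↔ i < n ∧ domB A [0, 1, 2, 3, 4] i = true ∧ ¬ domB A D i = true := by
    intro i
    simp only [hLC, List.mem_filter, List.mem_range, Bool.and_eq_true, Bool.not_eq_true',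
      Bool.eq_false_iff, ne_eq, D]
  have memD : ∀ i, i ∈ LD ↔ i < n ∧ domB A D i = true ∧ ¬ domB A [0, 1, 2, 3, 4] i = true := by
    intro i
    simp only [hLD, List.mem_filter, List.mem_range, Bool.and_eq_true, Bool.not_eq_true',
      Bool.eq_false_iff, ne_eq, D]
  have nodD : LD.Nodup := List.Nodup.filter _ List.nodup_range
  have b1 : LD.length ≤ {x | (∃ i ∈ D, x = f i ∨ G.Adj x (f i)) ∧
      ¬ ∃ i ∈ [0, 1, 2, 3, 4], x = f i ∨ G.Adj x (f i)}.ncard := by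
    rw [← List.toFinset_card_of_nodup nodD, ← Set.ncard_coe_finset,
      ← Set.ncard_image_of_injOn (f := f) (s := (LD.toFinset : Set ℕ))]
    · apply Set.ncard_le_ncard _ (Set.toFinite _)
      rintro x ⟨i, hi, rfl⟩
      have hi' := (memD i).1 (by simpa using hi)
      rw [domB_iff hI hDn hi'.1, domB_iff hI hCn hi'.1] at hi'
      exact hi'.2
    · intro i hi j hj h
      exact hI.inj i ((memD i).1 (by simpa using hi)).1 j ((memD j).1 (by simpa using hj)).1 h
  have b2 : {x | (∃ i ∈ [0, 1, 2, 3, 4], x = f i ∨ G.Adj x (f i)) ∧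
      ¬ ∃ i ∈ D, x = f i ∨ G.Adj x (f i)}.ncard ≤ LC.length := by
    refine le_trans ?_ (List.toFinset_card_le LC)
    rw [← Set.ncard_coe_finset]
    refine le_trans (Set.ncard_le_ncard ?_ (Set.toFinite _))
      (Set.ncard_image_le (f := f) (LC.toFinset.finite_toSet))
    rintro x ⟨hxC, hxD⟩
    by_cases h : ∃ i < n, x = f i
    · obtain ⟨i, hi, rfl⟩ := h
      refine ⟨i, ?_, rfl⟩
      rw [List.coe_toFinset]
      exact (memC i).2 ⟨hi, (domB_iff hI hCn hi).2 hxC, by rwa [domB_iff hI hDn hi]⟩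
    · exfalso
      have hxf : ∀ i < n, x ≠ f i := by rintro i hi h'; exact h ⟨i, hi, h'⟩
      obtain ⟨t, ht, htx⟩ := hI.ty x hxf
      obtain ⟨i, hi, h' | h'⟩ := hxC
      · exact hxf i (hCn i hi) h'
      · rcases hT t ht with hm | ⟨j, hj1, hj2⟩
        · apply hm
          refine ⟨i, (htx i (hCn i hi)).1 h', ?_⟩
          simp at hi
          rcases hi with rfl | rfl | rfl | rfl | rfl <;> rfl
        · rw [maskOf_testBit, decide_eq_true_eq] at hj2
          exact hxD ⟨j, hj2, Or.inr ((htx j (hDn j hj2)).2 hj1)⟩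
  omega

/-! #### type colourings -/

/-- a pair of traces excluded for adjacent unknown vertices -/
def BadPat (G : SimpleGraph V) (f : ℕ → V) (n : ℕ) (m : ℕ × ℕ × ℕ) : Prop :=
  ∀ z w s t, (∀ i < n, z ≠ f i) → (∀ i < n, w ≠ f i) → HasType G f n z s → HasType G f n w t →
    G.Adj z w → killsP s t m = true → False

theorem fork2_sound (hx : Ctx G c) (hI : KInv G c f n A T) {v0 l1 l2 p p2 q q2 : ℕ}
    (hF : fork2OK n A (nbMask n n v0 l1 l2 p p2 q q2) (nbMask n (Nat.succ n) v0 l1 l2 p p2 q q2)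
      v0 l1 l2 p p2 q q2 = true) :
    BadPat G f n (knMask n v0 l1 l2 p p2 q q2, nbMask n n v0 l1 l2 p p2 q q2,
        nbMask n (Nat.succ n) v0 l1 l2 p p2 q q2) := by
  intro z w s t hz hw hzs hwt hzw hk
  simp only [killsP, Bool.and_eq_true] at hk
  obtain ⟨hk1, hk2⟩ := hk
  unfold fork2OK at hF
  rw [Bool.and_eq_true] at hF
  obtain ⟨hle, hF⟩ := hF
  have hn := hI.n32
  set P1 := nbMask n n v0 l1 l2 p p2 q q2
  set P2 := nbMask n (Nat.succ n) v0 l1 l2 p p2 q q2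
  have hP1 : ∀ k, n ≤ k → P1.testBit k = false := fun k hk => nbMask_testBit hk
  have hP2 : ∀ k, n ≤ k → P2.testBit k = false := fun k hk => nbMask_testBit hk
  let g := Function.update (Function.update f n z) (n + 1) w
  have gz : g n = z := by simp [g]
  have gw : g (n + 1) = w := by simp [g]
  have gf : ∀ i < n, g i = f i := by
    intro i hi
    have h1 : i ≠ n := by omega
    have h2 : i ≠ n + 1 := by omega
    simp [g, h1, h2]
  have tri : ∀ i, i ≤ n + 1 → i < n ∨ i = n ∨ i = n + 1 := by intro i hi; omega
  have hbd := addv_bound (by omega) hI.bd hP1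
  have key : ∀ i, i ∈ [v0, l1, l2, p, p2, q, q2] → ∀ j, j ∈ [v0, l1, l2, p, p2, q, q2] → i ≤ j →
      (G.Adj (g i) (g j) ↔ adjB (addv (addv A n P1) (Nat.succ n)
        (Nat.lor P2 (Nat.shiftLeft 1 n))) i j = true) := by
    intro i hi j hj hij
    rcases tri j (mem_le hle hj) with hj' | rfl | rfl
    · have hi' : i < n := by omega
      rw [gf i hi', gf j hj', adjB_addv_old (by omega) (by omega) (by omega),
        adjB_addv_old (by omega) hi' hj', hI.adj i hi' j hj']
    · rw [adjB_addv_old (by omega) (by omega) (by omega), adjB_addv_new hI.bd hij, gz]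
      rcases hij.lt_or_eq with hi' | rfl
      · rw [gf i hi', G.adj_comm, hzs i hi', land_trace hk1 (knMask_testBit hi hi')]
      · rw [gz, hP1 _ le_rfl]; simp
    · rw [adjB_addv_new hbd hij, setBit_testBit, gw]
      rcases tri i hij with hi' | rfl | rfl
      · rw [gf i hi', G.adj_comm, hwt i hi', land_trace hk2 (knMask_testBit hi hi')]
        have : i ≠ n := by omega
        simp [this, P2]
      · rw [gz]; simp [hzw]
      · rw [gw, hP2 _ (by omega)]; simp
  refine isFork_sound hx g hle hF ?_ ?_
  · intro i hi j hj h
    have hzw' := hzw.ne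
    rcases tri i hi with hi' | rfl | rfl <;> rcases tri j hj with hj' | rfl | rfl <;>
      try simp only [gz, gw] at h
    · rw [gf i hi', gf j hj'] at h; exact hI.inj i hi' j hj' h
    · rw [gf i hi'] at h; exact absurd h.symm (hz i hi')
    · rw [gf i hi'] at h; exact absurd h.symm (hw i hi')
    · rw [gf j hj'] at h; exact absurd h (hz j hj')
    · rfl
    · exact absurd h hzw'
    · rw [gf j hj'] at h; exact absurd h (hw j hj')
    · exact absurd h.symm hzw'
    · rfl
  · intro i hi j hj
    rcases le_total i j with h | h
    · exact key i hi j hj h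
    · rw [G.adj_comm, adjB_comm]; exact key j hj i hi h

theorem readPats_sound (hx : Ctx G c) (hI : KInv G c f n A T) (k : ℕ) :
    ∀ l acc pats l', (∀ m ∈ acc, BadPat G f n m) → readPats n A k l acc = some (pats, l') →
    ∀ m ∈ pats, BadPat G f n m := by
  induction k with
  | zero =>
    intro l acc pats l' hacc h
    simp only [readPats, Option.some.injEq, Prod.mk.injEq] at h
    rw [← h.1]; exact hacc
  | succ k ih =>
    intro l acc pats l' hacc h
    rcases l with _ | ⟨v0, _ | ⟨l1, _ | ⟨l2, _ | ⟨p, _ | ⟨p2, _ | ⟨q, _ | ⟨q2, l⟩⟩⟩⟩⟩⟩⟩ <;>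
      try (simp [readPats] at h; done)
    rw [readPats] at h
    cases hF : fork2OK n A (nbMask n n v0 l1 l2 p p2 q q2)
      (nbMask n (Nat.succ n) v0 l1 l2 p p2 q q2) v0 l1 l2 p p2 q q2 with
    | false => rw [hF] at h; simp at h
    | true =>
      rw [hF] at h
      refine ih l _ pats l' ?_ h
      intro m hm
      rcases List.mem_cons.1 hm with rfl | hm
      · exact fork2_sound hx hI hF
      · exact hacc m hm

theorem zip_mem : ∀ (T tc : List ℕ), T.length = tc.length → ∀ t ∈ T, ∃ d, (t, d) ∈ List.zip T tc
  | [], _, _, t, ht => by simp at ht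
  | a :: T, [], h, _, _ => by simp at h
  | a :: T, b :: tc, h, t, ht => by
    rcases List.mem_cons.1 ht with rfl | ht
    · exact ⟨b, by simp⟩
    · obtain ⟨d, hd⟩ := zip_mem T tc (by simpa using h) t ht
      exact ⟨d, by simp [hd]⟩

open Classical in
theorem tcol_sound (hx : Ctx G c) (hI : KInv G c f n A T) {b : ℕ} {gc tc : List ℕ}
    {pats : List (ℕ × ℕ × ℕ)} (hpats : ∀ m ∈ pats, BadPat G f n m)
    (hC : tcolOK n A b T gc tc pats = true) : False := by
  simp only [tcolOK, Bool.and_eq_true, List.all_eq_true, Nat.blt_eq, and_assoc, List.mem_range,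
    Nat.ble_eq, nbeq] at hC
  obtain ⟨hb, hn1, hlen, hgc, htc, hpair⟩ := hC
  have hgc3 : ∀ i < n, nth gc i < 3 := fun i hi => (hgc i hi).1
  have hgcp : ∀ i < n, ∀ j < n, G.Adj (f i) (f j) → nth gc i ≠ nth gc j := by
    intro i hi j hj h
    have h' := (hI.adj i hi j hj).1 h
    have := (hgc i hi).2 j hj
    rw [h'] at this
    simp only [Bool.not_true, Bool.false_or, Bool.not_eq_true', Bool.eq_false_iff, ne_eq, nbeq]
      at this
    exact this
  have hty : ∀ z, ∃ x : ℕ × ℕ, (∀ i < n, z ≠ f i) → x ∈ List.zip T tc ∧ HasType G f n z x.1 := by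
    intro z
    by_cases hz : ∀ i < n, z ≠ f i
    · obtain ⟨t, ht, htz⟩ := hI.ty z hz
      obtain ⟨d, hd⟩ := zip_mem T tc hlen t ht
      exact ⟨(t, d), fun _ => ⟨hd, htz⟩⟩
    · exact ⟨(0, 0), fun h => absurd h hz⟩
  choose τ hτ using hty
  -- the outer part
  obtain ⟨col0, hc3, hcol⟩ := hx.sub {w | (∀ i < n, i ≠ b → w ≠ f i)} (by
    intro h
    have hex : ∃ i < n, i ≠ b := by
      by_cases h0 : b = 0
      · exact ⟨1, hn1, by omega⟩
      · exact ⟨0, by omega, by omega⟩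
    obtain ⟨i, hi, hib⟩ := hex
    have : f i ∈ {w | (∀ i < n, i ≠ b → w ≠ f i)} := by rw [h]; trivial
    exact this i hi hib rfl)
  let col : V → ℕ := fun w => Equiv.swap (col0 (f b)) (nth gc b) (col0 w)
  have col_b : col (f b) = nth gc b := by simp [col]
  have col3 : ∀ w, col w < 3 := by
    intro w
    have h1 := hc3 w
    have h2 := hc3 (f b)
    have h3 := hgc3 b hb
    simp only [col, Equiv.swap_apply_def]
    split_ifs <;> assumption
  have colp : ∀ x y, (∀ i < n, i ≠ b → x ≠ f i) → (∀ i < n, i ≠ b → y ≠ f i) → G.Adj x y →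
      col x ≠ col y := by
    intro x y h1 h2 h3 h
    exact hcol x h1 y h2 h3 ((Equiv.swap (col0 (f b)) (nth gc b)).injective h)
  let F : V → ℕ := fun w => if h : ∃ i < n, w = f i then nth gc (choose h) else
    if (τ w).2 = 3 then col w else (τ w).2
  have F1 : ∀ i < n, F (f i) = nth gc i := by
    intro i hi
    have h : ∃ j < n, f i = f j := ⟨i, hi, rfl⟩
    have : choose h = i := (hI.inj i hi _ (choose_spec h).1 (choose_spec h).2).symm
    simp only [F, dif_pos h, this]
  have F2 : ∀ w, (∀ i < n, w ≠ f i) → F w = if (τ w).2 = 3 then col w else (τ w).2 := by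
    intro w hw
    have h : ¬ ∃ j < n, w = f j := by rintro ⟨j, hj, h⟩; exact hw j hj h
    simp only [F, dif_neg h]
  have unk : ∀ w, (¬ ∃ i < n, w = f i) → ∀ i < n, w ≠ f i := by
    rintro w h i hi h'; exact h ⟨i, hi, h'⟩
  have key : ∀ i < n, ∀ w, G.Adj (f i) w → F (f i) ≠ F w := by
    intro i hi w hw
    by_cases hwk : ∃ j < n, w = f j
    · obtain ⟨j, hj, rfl⟩ := hwk
      rw [F1 i hi, F1 j hj]
      exact hgcp i hi j hj hw
    · have hw' := unk w hwk
      obtain ⟨m1, m2⟩ := hτ w hw'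
      have hbit := (m2 i hi).1 hw.symm
      have h5 := (htc _ m1).2 i hi
      rw [tb_eq, hbit] at h5
      rw [F1 i hi, F2 w hw']
      by_cases h3 : (τ w).2 = 3
      · rw [if_pos h3]
        rw [h3] at h5
        have hib : i = b := by simpa using h5
        subst hib
        rw [← col_b]
        refine colp _ _ ?_ (fun j hj _ => hw' j hj) hw
        intro j hj hji h
        exact hji (hI.inj j hj i hi h.symm)
      · rw [if_neg h3]
        have e3 : Nat.beq (τ w).2 3 = false := by
          rw [Bool.eq_false_iff, ne_eq, nbeq]; exact h3
        rw [e3] at h5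
        simp only [Bool.not_true, Bool.false_or, cond_false, Bool.not_eq_true',
          Bool.eq_false_iff, ne_eq, nbeq] at h5
        exact fun h => h5 h.symm
  refine hx.nc F ?_ ?_
  · intro w
    by_cases h : ∃ i < n, w = f i
    · obtain ⟨i, hi, rfl⟩ := h
      rw [F1 i hi]; exact hgc3 i hi
    · have hw' := unk w h
      rw [F2 w hw']
      have := (htc _ (hτ w hw').1).1
      split_ifs with h3
      · exact col3 w
      · omega
  · intro w w' hww
    by_cases h : ∃ i < n, w = f i
    · obtain ⟨i, hi, rfl⟩ := h
      exact key i hi w' hww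
    · by_cases h' : ∃ i < n, w' = f i
      · obtain ⟨i, hi, rfl⟩ := h'
        exact (key i hi w hww.symm).symm
      · have hw := unk w h
        have hw' := unk w' h'
        obtain ⟨m1, m2⟩ := hτ w hw
        obtain ⟨m1', m2'⟩ := hτ w' hw'
        have hp := hpair _ m1 _ m1'
        simp only [pairOK, Bool.or_eq_true, Bool.and_eq_true, Bool.not_eq_true',
          Bool.eq_false_iff, ne_eq, nbeq, Nat.blt_eq, meets_iff, List.any_eq_true] at hp
        rw [F2 w hw, F2 w' hw']
        rcases hp with ⟨⟨q1, q2⟩, q3⟩ | ⟨q1, q2⟩ | ⟨i, q1, q2⟩ | ⟨m, hm, q | q⟩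
        · rw [if_neg (by omega), if_neg (by omega)]; exact q3
        · rw [if_pos q1, if_pos q2]
          exact colp w w' (fun i hi _ => hw i hi) (fun i hi _ => hw' i hi) hww
        · exfalso
          have hi : i < n := by
            by_contra hi
            rw [hI.tbd _ (List.of_mem_zip m1).1 i (by omega)] at q1
            simp at q1
          exact hx.tf w w' (f i) hww ((m2' i hi).2 q2) ((m2 i hi).2 q1)
        · exact (hpats m hm w w' _ _ hw hw' m2 m2' hww q).elim
        · exact (hpats m hm w' w _ _ hw' hw m2' m2 hww.symm q).elim

theorem tcolRun_sound (hx : Ctx G c) (hI : KInv G c f n A T) {b : ℕ} {l l' : List ℕ}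
    (h : tcolRun n A b T l = some l') : False := by
  unfold tcolRun at h
  split at h
  · simp at h
  · split at h
    · simp at h
    · rename_i gc k l1 _ _ pats l2 hrp
      cases hC : tcolOK n A b T gc (readN (List.length T) l2).1 pats with
      | false => rw [hC] at h; simp at h
      | true => exact tcol_sound hx hI (readPats_sound hx hI _ _ _ _ _ (by simp) hrp) hC

theorem cond_none {α : Type} {b : Bool} {x : Option α} {y : α}
    (h : cond b x none = some y) : b = true ∧ x = some y := by
  cases b with
  | true => exact ⟨rfl, h⟩
  | false => simp at h

theorem nth_bound (hI : KInv G c f n A T) (i : ℕ) : ∀ k, n ≤ k → (nth T i).testBit k = false := by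
  intro k hk
  unfold nth
  by_cases h : i < T.length
  · rw [List.getD_eq_getElem _ _ h]
    exact hI.tbd _ (List.getElem_mem h) k hk
  · rw [List.getD_eq_default _ _ (by omega)]; simp

theorem run_succ (k n A : ℕ) (T : List ℕ) (op : ℕ) (l : List ℕ) :
    run (k + 1) n A T (op :: l) =
    cond (Nat.beq op 0)
      (match l with
        | c :: l1 :: l2 :: p :: p2 :: q :: q2 :: l =>
          cond (forkOK n A (nbMask n n c l1 l2 p p2 q q2) c l1 l2 p p2 q q2)
            (run k n A (List.filter (fun t => !(Nat.beq (Nat.land t (knMask n c l1 l2 p p2 q q2))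
              (nbMask n n c l1 l2 p p2 q q2))) T) l) none
        | _ => none)
    (cond (Nat.beq op 1)
      (match l with
        | i :: l =>
          cond (Nat.blt n 31)
            (match run k (Nat.succ n) (addv A n (nth T i)) (childT n (nth T i) T) l with
              | none => none
              | some l' => run k n A (List.filter (fun t => !(Nat.beq t (nth T i))) T) l') none
        | _ => none)
    (cond (Nat.beq op 2)
      (match l with
        | x1 :: y1 :: x2 :: y2 :: l => cond (homOK n A T x1 y1 x2 y2) (some l) none
        | _ => none)
    (cond (Nat.beq op 3)
      (match l with
        | m :: l => cond (colOK n A T (readN m l).1) (some (readN m l).2) none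
        | _ => none)
    (cond (Nat.beq op 4)
      (match l with
        | d0 :: d1 :: d2 :: d3 :: d4 :: l => cond (goodOK n A T d0 d1 d2 d3 d4) (some l) none
        | _ => none)
      (match l with
        | b :: l => tcolRun n A b T l
        | _ => none))))) := rfl

theorem run_sound (hx : Ctx G c) (k : ℕ) : ∀ (f : ℕ → V) (n A : ℕ) (T l l' : List ℕ),
    KInv G c f n A T → run k n A T l = some l' → False := by
  induction k with
  | zero => intro f n A T l l' _ h; simp [run] at h
  | succ k ih =>
    intro f n A T l l' hI h
    rcases l with _ | ⟨op, l⟩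
    · simp [run] at h
    rw [run_succ] at h
    cases o0 : Nat.beq op 0 with
    | true =>
      rw [o0, cond_true] at h
      split at h
      · obtain ⟨h1, h2⟩ := cond_none h
        exact ih f n A _ _ l' (fork_sound hx hI h1) h2
      · simp at h
    | false =>
    rw [o0, cond_false] at h
    cases o1 : Nat.beq op 1 with
    | true =>
      rw [o1, cond_true] at h
      split at h
      · rename_i i l
        obtain ⟨h1, h2⟩ := cond_none h
        rw [Nat.blt_eq] at h1
        split at h2
        · simp at h2
        · rename_i l2 hrun
          refine ih f n A _ _ l' (branch_rest hI ?_) h2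
          intro z hz hzs
          exact ih _ _ _ _ _ _ (branch_child hx hI h1 hz (nth_bound hI i) hzs) hrun
      · simp at h
    | false =>
    rw [o1, cond_false] at h
    cases o2 : Nat.beq op 2 with
    | true =>
      rw [o2, cond_true] at h
      split at h
      · exact hom_sound hx hI (cond_none h).1
      · simp at h
    | false =>
    rw [o2, cond_false] at h
    cases o3 : Nat.beq op 3 with
    | true =>
      rw [o3, cond_true] at h
      split at h
      · exact col_sound hx hI (cond_none h).1
      · simp at h
    | false =>
    rw [o3, cond_false] at h
    cases o4 : Nat.beq op 4 with
    | true =>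
      rw [o4, cond_true] at h
      split at h
      · exact good_sound hx hI (cond_none h).1
      · simp at h
    | false =>
    rw [o4, cond_false] at h
    split at h
    · exact tcolRun_sound hx hI h
    · simp at h

/-! ### The context of a minimal counterexample -/

theorem fork_sound_graph {G : SimpleGraph V} (hF : ForkFree G) : ∀ c l1 l2 p p2 q q2, G.Adj c l1 →
    G.Adj c l2 → G.Adj c p → G.Adj c q → G.Adj p p2 →
    G.Adj q q2 → l1 ≠ l2 → ¬ G.Adj l1 l2 → ¬ G.Adj l1 p → ¬ G.Adj l1 p2 → ¬ G.Adj l1 q →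
    ¬ G.Adj l1 q2 → ¬ G.Adj l2 p → ¬ G.Adj l2 p2 → ¬ G.Adj l2 q → ¬ G.Adj l2 q2 →
    ¬ G.Adj c p2 → ¬ G.Adj c q2 → ¬ G.Adj p q → ¬ G.Adj p q2 → ¬ G.Adj p2 q →
    ¬ G.Adj p2 q2 → False := by
  intro c l1 l2 p p2 q q2 e1 e2 e3 e4 e5 e6 ne f1 f2 f3 f4 f5 f6 f7 f8 f9 f10 f11 f12 f13 f14 f15
  have hadj : ∀ i j : Fin 7, G.Adj (![c, l1, l2, p, p2, q, q2] i) (![c, l1, l2, p, p2, q, q2] j) ↔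
      fork.Adj i j := by
    have hlt : ∀ i j : Fin 7, i < j → (G.Adj (![c, l1, l2, p, p2, q, q2] i)
        (![c, l1, l2, p, p2, q, q2] j) ↔ fork.Adj i j) := by
      intro i j hij
      fin_cases i <;> fin_cases j <;>
        first
        | exact absurd hij (by decide)
        | exact iff_of_true (by assumption) (by simp [fork])
        | exact iff_of_false (by assumption) (by simp [fork])
    intro i j
    rcases lt_trichotomy i j with h | rfl | h
    · exact hlt i j h
    · simp
    · rw [G.adj_comm, fork.adj_comm]; exact hlt j i h
  have sep : ∀ i j : Fin 7, i ≠ j → (∃ k, ¬ (fork.Adj i k ↔ fork.Adj j k)) ∨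
      (i = 1 ∧ j = 2) ∨ (i = 2 ∧ j = 1) := by
    have hfa : ∀ i j : Fin 7, fork.Adj i j ↔
        (s(i, j) ∈ ([s(0, 1), s(0, 2), s(0, 3), s(0, 5), s(3, 4), s(5, 6)] :
          List (Sym2 (Fin 7))) ∧ i ≠ j) := by
      intro i j; simp [fork]
    simp only [hfa]
    clear * -
    decide +kernel
  refine hF.false ⟨⟨![c, l1, l2, p, p2, q, q2], ?_⟩, fun {i j} => hadj i j⟩
  intro i j hij
  by_contra hne
  rcases sep i j hne with ⟨k, hk⟩ | ⟨rfl, rfl⟩ | ⟨rfl, rfl⟩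
  · apply hk
    rw [← hadj, ← hadj, hij]
  · exact ne hij
  · exact ne hij.symm

theorem minCex_sub [Fintype V] (hG : MinCex G) (S : Set V) (hS : S ≠ Set.univ) :
    ∃ col : V → ℕ, (∀ x, col x < 3) ∧ ∀ x ∈ S, ∀ y ∈ S, G.Adj x y → col x ≠ col y := by
  classical
  obtain ⟨h3, hF, h4, hmin⟩ := hG
  have hcard : Fintype.card S < Fintype.card V := by
    obtain ⟨x, hx⟩ := (Set.ne_univ_iff_exists_notMem S).1 hS
    exact Fintype.card_subtype_lt hx
  have hle := hmin S (G.induce S) hcard (h3.comap ⟨(SimpleGraph.Embedding.induce S).toCopy⟩)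
    ⟨fun e => hF.false (e.trans (SimpleGraph.Embedding.induce S))⟩
  have hcol : (G.induce S).Colorable 3 := SimpleGraph.chromaticNumber_le_iff_colorable.1 hle
  obtain ⟨C⟩ := hcol
  refine ⟨fun x => if h : x ∈ S then (C ⟨x, h⟩ : ℕ) else 0, ?_, ?_⟩
  · intro x
    dsimp only
    split_ifs
    · exact (C _).2
    · omega
  · intro x hx y hy hxy
    simp only [dif_pos hx, dif_pos hy]
    intro h
    exact C.valid (v := ⟨x, hx⟩) (w := ⟨y, hy⟩) hxy (Fin.ext h)

theorem minCex_nc [Fintype V] (hG : MinCex G) : ∀ col : V → ℕ, (∀ x, col x < 3) →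
    (∀ x y, G.Adj x y → col x ≠ col y) → False := by
  intro col h3 hp
  have hc : G.Colorable 3 :=
    ⟨SimpleGraph.Coloring.mk (fun x => (⟨col x, h3 x⟩ : Fin 3)) (by
      intro x y hxy h
      exact hp x y hxy (by simpa using h))⟩
  have h1 := SimpleGraph.chromaticNumber_le_iff_colorable.2 hc
  have h2 := le_trans hG.2.2.1 h1
  exact absurd h2 (by decide)

theorem minCex_conn [Fintype V] (hG : MinCex G) (x y : V) : G.Reachable x y := by
  classical
  by_contra hxy
  obtain ⟨c1, h1, p1⟩ := minCex_sub hG {w | G.Reachable x w} (fun h => hxy (by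
    have : y ∈ {w | G.Reachable x w} := by rw [h]; trivial
    exact this))
  obtain ⟨c2, h2, p2⟩ := minCex_sub hG {w | ¬ G.Reachable x w} (fun h => by
    have : x ∈ {w | ¬ G.Reachable x w} := by rw [h]; trivial
    exact this (SimpleGraph.Reachable.refl x))
  refine minCex_nc hG (fun w => if G.Reachable x w then c1 w else c2 w) ?_ ?_
  · intro w
    split_ifs
    · exact h1 w
    · exact h2 w
  · intro w w' hw
    by_cases h : G.Reachable x w
    · have h' : G.Reachable x w' := h.trans hw.reachable
      rw [if_pos h, if_pos h']
      exact p1 w h w' h' hw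
    · have h' : ¬ G.Reachable x w' := fun h' => h (h'.trans hw.symm.reachable)
      rw [if_neg h, if_neg h']
      exact p2 w h w' h' hw

theorem two_le_distC [Fintype V] (hG : MinCex G) (d : Fin 5 → V) (x : V) :
    2 ≤ distC G d x ↔ ¬ ∃ i, x = d i ∨ G.Adj x (d i) := by
  unfold distC
  rw [Finset.le_inf'_iff]
  push Not
  constructor
  · intro h i
    have hi := h i (Finset.mem_univ i)
    constructor
    · rintro h'
      rw [h', SimpleGraph.dist_self] at hi
      omega
    · intro h'
      rw [SimpleGraph.dist_eq_one_iff_adj.2 h'] at hi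
      omega
  · intro h i _
    have h0 : G.dist x (d i) ≠ 0 := by
      intro h0
      exact (h i).1 ((minCex_conn hG x (d i)).dist_eq_zero_iff.1 h0)
    have h1 : G.dist x (d i) ≠ 1 := by
      intro h1
      exact (h i).2 (SimpleGraph.dist_eq_one_iff_adj.1 h1)
    omega

theorem ncard_swap [Finite V] (P Q : V → Prop)
    (h : {x | ¬ P x}.ncard ≤ {x | ¬ Q x}.ncard) :
    {x | Q x ∧ ¬ P x}.ncard ≤ {x | P x ∧ ¬ Q x}.ncard := by
  have e1 : {x | ¬ P x} = {x | Q x ∧ ¬ P x} ∪ {x | ¬ P x ∧ ¬ Q x} := by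
    ext x; simp only [Set.mem_ofPred_eq, Set.mem_union]; tauto
  have e2 : {x | ¬ Q x} = {x | P x ∧ ¬ Q x} ∪ {x | ¬ P x ∧ ¬ Q x} := by
    ext x; simp only [Set.mem_ofPred_eq, Set.mem_union]; tauto
  rw [e1, e2, Set.ncard_union_eq, Set.ncard_union_eq] at h
  · omega
  · rw [Set.disjoint_left]; rintro x ⟨h1, h2⟩ ⟨h3, h4⟩; exact h3 h1
  · rw [Set.disjoint_left]; rintro x ⟨h1, h2⟩ ⟨h3, h4⟩; exact h4 h1

theorem ctx_of_good [Fintype V] (hG : MinCex G) (c0 : Fin 5 → V) (hc : GoodC5 G c0) (c : ℕ → V)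
    (hcc : ∀ x, (∃ i < 5, x = c i ∨ G.Adj x (c i)) ↔ ∃ i, x = c0 i ∨ G.Adj x (c0 i)) :
    Ctx G c where
  fin := inferInstance
  tf := by
    intro x y z h1 h2 h3
    classical
    exact hG.1 {x, y, z} (SimpleGraph.is3Clique_triple_iff.2 ⟨h1, h3, h2⟩)
  fk := fork_sound_graph hG.2.1
  sub := minCex_sub hG
  nc := minCex_nc hG
  good := by
    intro d hinj hadj
    let d0 : Fin 5 → V := fun i => d i
    have hd0 : IsC5 G d0 := by
      refine ⟨fun i j h => Fin.ext (hinj i i.2 j j.2 h), ?_⟩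
      intro i
      have := hadj i i.2
      have e : ((i + 1 : Fin 5) : ℕ) = (i + 1) % 5 := by rw [Fin.val_add]; rfl
      show G.Adj (d i) (d ((i + 1 : Fin 5) : ℕ))
      rw [e]; exact this
    have hdd : ∀ x, (∃ i < 5, x = d i ∨ G.Adj x (d i)) ↔ ∃ i, x = d0 i ∨ G.Adj x (d0 i) := by
      intro x
      constructor
      · rintro ⟨i, hi, h⟩; exact ⟨⟨i, hi⟩, h⟩
      · rintro ⟨i, h⟩; exact ⟨i, i.2, h⟩
    have := hc.2 d0 hd0
    simp only [two_le_distC hG] at this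
    simp only [hcc, hdd]
    exact ncard_swap _ _ this

/-! ### The root -/

def rootF (c : ℕ → V) (u a b : V) : ℕ → V
  | 5 => u
  | 6 => a
  | 7 => b
  | i => c i

def sepOK (A : ℕ) : Bool :=
  List.all (List.range 8) (fun i => List.all (List.range 8) (fun j =>
    Nat.beq i j || (Nat.beq i 6 && Nat.beq j 7) || (Nat.beq i 7 && Nat.beq j 6) ||
      List.any (List.range 8) (fun k => adjB A i k != adjB A j k)))

open Classical in
theorem root_inv (hx : Ctx G c) {u a b : V} (hab : a ≠ b) {A : ℕ} (hs : sepOK A = true)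
    (hA : A < 2 ^ 256)
    (hadj : ∀ i < 8, ∀ j < 8, i < j →
      (G.Adj (rootF c u a b i) (rootF c u a b j) ↔ adjB A i j = true))
    (hd : ∀ i < 8, adjB A i i = false) :
    KInv G c (rootF c u a b) 8 A (T0 A) := by
  have hadj' : ∀ i < 8, ∀ j < 8,
      (G.Adj (rootF c u a b i) (rootF c u a b j) ↔ adjB A i j = true) := by
    intro i hi j hj
    rcases lt_trichotomy i j with h | rfl | h
    · exact hadj i hi j hj h
    · rw [hd i hi]; simp
    · rw [G.adj_comm, adjB_comm]; exact hadj j hj i hi h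
  refine ⟨by omega, by omega, ?_, ?_, hadj', ?_, ?_, ?_⟩
  · intro i hi
    interval_cases i <;> rfl
  · intro i hi j hj h
    simp only [sepOK, List.all_eq_true, List.mem_range, Bool.or_eq_true, Bool.and_eq_true, nbeq,
      List.any_eq_true, bne_iff_ne, ne_eq] at hs
    rcases hs i hi j hj with ((h1 | ⟨rfl, rfl⟩) | ⟨rfl, rfl⟩) | ⟨k, hk, hne⟩
    · exact h1
    · exact absurd h hab
    · exact absurd h.symm hab
    · exfalso; apply hne
      rw [Bool.eq_iff_iff, ← hadj' i hi k hk, ← hadj' j hj k hk, h]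
  · intro k hk
    exact Nat.testBit_lt_two_pow (lt_of_lt_of_le hA (Nat.pow_le_pow_right (by omega) hk))
  · intro t ht k hk
    simp only [T0, List.mem_filter, List.mem_range] at ht
    exact Nat.testBit_lt_two_pow (lt_of_lt_of_le ht.1
      (show 2 ^ 8 ≤ 2 ^ k from Nat.pow_le_pow_right (by omega) hk))
  · intro z hz
    have htb : ∀ i, (maskOf ((List.range 8).filter (fun i => decide (G.Adj z (rootF c u a b i))))).testBit i =
        decide (i < 8 ∧ G.Adj z (rootF c u a b i)) := by
      intro i
      rw [maskOf_testBit]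
      simp [List.mem_filter]
    refine ⟨maskOf ((List.range 8).filter (fun i => decide (G.Adj z (rootF c u a b i)))), ?_, ?_⟩
    · simp only [T0, List.mem_filter, List.mem_range, List.all_eq_true]
      refine ⟨?_, ?_⟩
      · show _ < 2 ^ 8
        apply Nat.lt_pow_two_of_testBit
        intro i hi
        rw [htb]
        simp; omega
      · intro i hi j hj
        rw [Bool.not_eq_true', Bool.eq_false_iff]
        intro h
        simp only [Bool.and_eq_true, tb_eq, htb, decide_eq_true_eq] at h
        exact hx.tf z _ _ h.1.1.2 ((hadj' i hi j hj).2 h.2) h.1.2.2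
    · intro i hi
      rw [htb]
      simp [hi]

theorem runs_false (hx : Ctx G c) {E : List (ℕ × ℕ)} (hI : KInv G c f 8 (mkA E) (T0 (mkA E)))
    {l : List ℕ} (h : runs E l = true) : False := by
  unfold runs at h
  obtain ⟨l', hl'⟩ := Option.isSome_iff_exists.1 h
  exact run_sound hx _ f 8 _ _ _ l' hI hl'

def cert2 : List ℕ :=
  [121541904642545574837498071061129399138651682805186197636568155936290962737851285760,
   91662899463504170472783985672656259457066771895685039283093487130983094309456249988,
   15185459688153190126153517307229858318371765053987850837409715288412063524557162113,
   106597278253956106500395861428520132957276416921363935466120146904572940392956232328,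
   60715828389080058495206562555866997338452907724095046280293539614063755749866080257,
   121774407923351300300018951966296559103611311384806681651001740377221519498287252613,
   31423259259004297808140431807531074660936930264100205233845547016914451941291999369,
   15541173269859068771817275021588749340335026731474476713743671213896735363080126721,
   152605701833136526477348713934907255215831694584887529393737186076719128047672934401,
   167072251690706423008606973417141989542079479150630382041791969726363460742523388420,
   31430619236233156591377657632853571864647897344412769553978056231723409136374825216,
   6955878523070673419321920203889658401681525373516500564316643584426753,
   106482463384837071459749390104906494967207355333177492296890274622602252873164144768,
   46124215561992915762739920813899376829801103865857566131003904651854911541688352905,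
   45769370927606910716354961778168542582412676220798421381143431371263358399380882562,
   122254264930027630356677746614159501520164591187918562574229876468840472318381883528,
   106840912384191581652363105996441189667688429581255664584620631652459141980433155969,
   137783381117085730165678532582110514923408150278551482185390965260738877038413283850,
   46718004965213041124863985430762880992698926644056096022487358670712215880729624578,
   16009942615911528290619216298104644467524810930800390129042957330236644445965565956,
   152013765718234746294896741492418214647323521602928573848303219557208001403257126927,
   15184533521084215533624709224831769005283549473719349898615290152186640190591206153,
   136712506819135654177412212837761810044315063913694926889618305566665693876988150917,
   152603784421555594288080182197693281391450428945355074740173627432464143424828752776,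
   152018411592232719653941549108358201596715742509843419770892897211337302097359077506,
   61064181881724604883688493527186503031661096281449170546258462520712857306043401481,
   15178027115995805264409225820269514531861510577733990206605712206698877143440523530,
   31072141346775818300640210547387678630467173518379886708715424101243198625214906370,
   106952057981030757885591922614328349186604561068521876349878645176112479283550668043,
   16012656440894733654863083923455498592341402022321469656710074122767487943103890691,
   46835592059774061038801058723255401677830908813330440817744635950790585434098516490,
   137545269046522757123691007847592362350299355834624406775101541374659074542455128201,
   61663492728867389226593867117265510161681388078278436768774088729865263726119125376,
   106953056910833788108062621246248829931623909804038083667436020470103259706793526016,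
   136833863881641271967099371037685169308092617055520709413070132978047770948974673929,
   238068592011164882547560042142694896110967049049629039010685709387444206117601418,
   31539934375969418494812828063812270020313412372584926352855239171432089950353359105,
   31539978134152383131762007994462401608585262679756551176008250573445144098180809353,
   107192920563841563682096987897587589602121404022748566666777568600626679534242103817,
   1193150635969022378882951649753276790013812481903820548307292642314881235664503300,
   30947100362609423311744162606797821626216131431012592060329024999949790178644738438,
   151774777799444491038574567932005277606632741969402404978187561396821517535121933448,
   9270943841643460119918056349189536352165162559744174018137438709800316900000005,
   106713989554654795047354968855440028701296652147503447415779481422605224501626029190,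
   30713620313515279111599849109621148631853992740352486882025242301905300448845381894,
   15889497132992196874845673423253599615371443187097419606218519414560062052239540361,
   15415169369505381336372203821622172329361767928504831696263807611740149662668062724,
   137307185980921579543595802390757633461110693912521014317197910147068353957182095876,
   136840377297999735425557646491250990766402466865811243062388507937236059268703110145,
   91062611618423828313799168133336893329203059130189935638144115042379664272901932168,
   30472801662024783700434325677347582654371216801751766988666201371387856796262744199,
   106597278253962981495762102975701422055497770930308222152098161767995837509097553929,
   152130426642134406930224133771691386069371533241950476619419127654873129547915592193,
   152130426415984724520776239979470950459677508136801468056475040507500731052396249856,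
   15182666491078532873721193626558220378355124244162879037370926811239414239416419072,
   46005659439296633820917095313892086730290490530427457166097252002675466995891176706,
   1304318900130905260999939142760189479414328113485756666165018697291477856586579976,
   152016501365087191933975627767025684819037298122336564390166368363070654743538876677,
   106247181210498267346604383920340810878505170744958071382841180586785098918717817347,
   61072461015669968109004323697345620723288684194629716674032279785357477389598245504,
   1070852595791844322294024096264385041228949407776430289454442913016755222665643010,
   122246883180342722444839172840891065023741232394776656012720758170178667024658628996,
   121657718895526549642751145751324339050606128420526184934625853379554813853321707530,
   152484286986801649720729154116974980808709097045299517135147168773760279591600047234,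
   137307236640844261557411007915238740045935043543718441899367989621632585791961089153,
   31543639497123887283684421018111939410045618682834969755428439928151413467847360520,
   1867260958876058557271141351222247098397575783052230288264887055539635140838278,
   128]

theorem cert2_ok : runs ((3, 7) :: baseE) cert2 = true := by
  decide +kernel


def cert1 : List ℕ :=
  [122249611757601504237554602742797131101593611803928288858941074963469837832103673856,
   60715828445626066314461651666273181119843534914685964359811533082799285109935572609,
   46005616020358361475912912657700791301848103201157236374951477003673354786928854149,
   136951473983208276257742290952831709109444612617216158156683981585312259803201946498,
   61658846065978914888627909613359960683507187800498147045135992003530167786328457217,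
   45776781786507947507301431560849645549699835756714379299682756254967511891361023232,
   91071933219054544409384262386932514363516131328369260863429227000121556508333835525,
   30472802113043393292976263371662720808676879124361542088962775568730798458119651720,
   167311232145012913231301846940780909643083478860262490766773963397748548551839859210,
   11138317454435592647851515968791818634122093516376698820885392039009189923767553,
   153077229439061384825195995456170164963619627112055873890285312781737001950013096705,
   45541550498254718625429785391897379342068454394693143106336515347876485444231251211,
   118571330843231185669732907091056181432826927965443728933002596510008799689475588,
   15414265087919258572448564288490442982809796589922700452851507747029995865140937741,
   15180842539533820676022266426332738161095797887075449596972661246942601124258054534,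
   153193911793104175446377788646911342830454450163855594689896099614728089870073364608,
   1658461286119007937182772096017612069250129127559370452597146370,
   15189208401386537681113420553514789919840587094021634187820259172723792156324528128,
   212965744724013572073273815117427138016124806440657393701420327370408016222816830466,
   1547083861307331618781626718683000296400575000319643605633802420597779999018254720,
   15182731510646793412519574649246789559722114822050567478916606178918084493988545027,
   60708504937791009998914948300186576254699959311234433591057654424654877466956924040,
   182126135779327283833553493179798649630372816337803463924082208384304959197127245958,
   122965734949687906912757086424381087244669747291189116755115814510150269636689757833,
   15178960631388595590545346565375072931710819753896061696176349376372694291480313985,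
   30482991194948828378358020343374114226690080194926156947959180381409344846406090753,
   166958333985071516011887718654430125510468663901155323560459992700988650394505758350,
   166959275248972161778649002739304930619784162609077676177875123014322156007938147844,
   198725191960452684464359081440157242877805286588481304764789578274723717568255886852,
   61431959212075461890111088585434758083352836082343865931844330042572080877477594626,
   15177137532810386589626610901526497963828946690140544676496424957507662225459954176,
   16612003532217200428895100443968320161680372904560845011626976185147140547683582080,
   76243156420849871073036246272189314901040848147204329952943712970873358915026813954,
   77077706305247186196081312266443047022106677420575837627249004067254715773102505995,
   122844384724390189534690517485527004250945221918792810799490151111159167362566980481,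
   600266420745059988761152754727245982141321780581654977901493603456709630049255683,
   953229430606392626387997509075268110799067589639721869159887190112750385708024070,
   15893224359577739191350510292461172823419920788232823610857326580754054090422583426,
   76954568543554416948019803573850792860599627166636729482227479874587521017956073481,
   136951508644306358472327635332668610669502126900656080601867781948573831130809139720,
   137782454387251757719480391710943572314002661093748988005674753833158779407769305098,
   77074073783821165858130833665563703729981640773409468496079933145290561738703472007,
   91181176553704655005213958136072138471979837550693087807365049818004616711375963270,
   121893869682840128325830400756728316829125304523543504392829970588875497113164825732,
   10197281007686832292604022275022528268980967606494905183600451489983529631236226,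
   45540601884239198140705947377934953035750324577655407575008237155248557621193491718,
   273311059683546502377356005391426223112885993387577836624661881577321487510494282756,
   30365325005291045317201816269919677158578223626347539747121493692384047304538062976,
   167903161647931372653902403919467838614959032794353495390878449505375504887504274691,
   77197268763948385063853063017888554887121573753335220134922838069574114776633655426,
   168133819428749874566453906791926029910406893725671869940881685884489876174811448454,
   151782203078926570112531164074881394842357523815471362709102736547772400493704349188,
   238105232005539440804248461305168380937952568639659992817105519525845890465038595,
   168374688515752608598408939290695166972126090196407059088153149615824748614741278977,
   121535442167921790690273610681071328353220824959465938704692775799198250080703480067,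
   76952686923439825028253355052801091456262998235978994506691999883126403128109301765,
   121654874527096274099714664377856826504728485177148069326731561776131154429847061768,
   1069947853903806674607038411410541886322403566032104979870217001795974832226254980,
   106479655202287156072008732819134701053292373507268871687967341998370181972117062662,
   15422609350104272765447660246023409926377123940878379655633834431498735521990968577,
   152487130847719339094384862868654050888239829955010752222829114286248519840795985157,
   30358840701299167545382002974331425989624759601956729989673542053300022192912744705,
   30362567985331503195536153074918188197820363827501483180019063229985005992417559297,
   482650941820533598874508313904031558340194637831869218312301065033315344952951939,
   15179916427202786764487549179316284520108729466099324642017698345517182738860426372,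
   3478048720637703894222944259052200438999540754739605119860144083075200,
   364057569118809720651790579389876474265979460191856972805489043075455550931075072,
   92252085853316253158957995557955814846682729306336568387976896536326287840287785606,
   91066317361491371280412789729653348575577728320510328983060243803985558318304198664,
   106248085950156988045822243015696698226107347884361358221353660774752995331616572032,
   61072461015669968104029243512607135658991674158826209605593151271204239333931385472,
   76605275033430186121362474529704073897217185899294185910797924234977441778180867328,
   151899811543516858501338295838993196392840865979905676669364701315817187314451350016,
   137310037591692807998542504709840596812953046314722243265971162978338203452091400707,
   168137524776033133691853885534051647352703780159939675829964607320204337579796004865,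
   121900361390790827769439818049747889188071151972687950245102291741500884552461090944,
   107317093216382820840886569140776894237605836493726092017456841966661424074029334528,
   167659621875283661761203784324495091062678820105740916303858344829821031200120111882,
   1430307313162083535211160512296466335947181502970730715886138374658305006267121923,
   1431212051927028716153805556362348912883866785938492353240814747102987212204147076,
   45779561140735992800926467368063609935281701669428553175884542733478049540993106948,
   60712159002365820698258362213598838130601874674207273295554885367986646959842821632,
   949517299075297360796337959171510850066212072743442063275920633543160350973722883,
   1186695397052828502295664395305080800943302115622415895056092358211894221742440455,
   61901568108656305953211452522570406312072185222309145398406449626477643551115198727,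
   121431634842643431640541944822116607098072594201608481478712345547639183962785497600,
   45768538500149913448515281881713576170648696299639908221777198092519006989149357187,
   61777417164447030117187730879508203714821233159106544720252192703357848968608514185,
   152128609364851113204879801739435558193043276884918756731423558364250295105398850570,
   1069035992526088580064662948988248652315148329070975096601850351506653397506916361,
   91062640851764385107915264553286025345734705151759190249390705773383400715976835716,
   31184271790763682605045801142490145761288604432569262618263552763291661834526032007,
   1305244958124678257131948088429185653797918025758823668665491614169864817608818693,
   106256386910851527854270345212561010340860677838313119871421566449309146991286207232,
   121420591059502960030303492023826009803777397623072427712414533952502754343209026178,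
   106476927416572083645297057345442128385223311497121770077930752408594924940346606857,
   30365382785182696644922176995386311390965334919007157622802006033687749398544679051,
   182367909491119496908971393992154397510229891303893516560164614832276835838998889991,
   31658490773434708463706493595457445409889205191145339037663463154118386312869396992,
   182484627522615391614406019833552226593307934377000984589760009643575989337168479363,
   62260943216353100278059052593224470976399390771602929146802189294213427076459085963,
   183075710513251883759848763275661117518973467943385958072952585573218039594506814219,
   15177100777497777501729357741822821286565880422082588352587297673484646409639575563,
   445189814915638695942575966932541711306438073840161688692028261584275204,
   60712159002365820698258362213551307151526360215426320359516421880077504452757553152,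
   45768509836120715453234181220955524334708514017534171246086509254075661332531740931,
   481738630787113999426611232950620269652725629456671956977125398211364794098909318,
   46718019495763167704335970423892206224528782596050731326615067942766130764464668673,
   152609400001734155515987207832918850765686089882530864018250810876546140524458819588,
   16371192563443823923611697383553989011109018137925262965343555447156463993832538246,
   46955082314961997176079002048775740837109541687827660174516965693113147216145612808,
   76724772526103910386231026712177605302537464294070993381686868926072542759064027906,
   107309667427603758430216276870443040128869467743079777756687696397832080979245760642,
   16247945969734553983619168859831197046002453332131022127656653757475939509380169736,
   136721762775248402791305023089778847906810900137686932114288914333667476440633918722,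
   167778105734852927154826485154551404090077980661675633299186569141141723618671067782,
   152011877084178911536032068131409090864848617523023624011262830215207232394877797633,
   137898247095769265412063737086921813905987778152598224291378520338174171379533006091,
   475261850903082851046607973538173201258740323594218588360624174423813010617368844,
   106244387952077386090825500976352135034251580364181900566724222607939103396827709964,
   183668507774860760988114032171199542319306794180769072751042454041524488885820720777,
   171850302991801687316306256630045142415797344276424785072965314089003876480,
   122257927360595714651877040197591495740093572883312597088105570351935747161164103680,
   168376519592131914539077465245057263303732611948056580372534508661396323171286778752,
   182250293050560821378922289861009363849032306386743564214773943559301011315559023104,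
   480783399908764639441069803371702534988163156724860317834426051729760268236916358,
   77073075017409839789900003317418013653493584712175521484046906648374057870144078212,
   598478711198673322478270598625165390044163263503854862562650490400710391362519682,
   107549617756793243035271622511524830240058584354959101922598092093178977806335508866,
   46718019439224033833906326401059582038178852634043796623805178235581227615700124169,
   1193128929376173323695035456289481967053810531094746159749048923238887196752642052,
   212598060798495509832300917858006364161814806374168250368211528758931975843736633994,
   720711787525445547096645260069816335879906466653081308116296298937850130249924608,
   712433051575755826276475074555958984264717747809956212984808053410987841721239053,
   15415263736406864624131754055854658258340987104411100590317017190839731633313235840,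
   360432391185573069900318076367140908001934857326192692643376942670606251019289991,
   182841361522131506476487998722016854412431968304218130979338153160159125012318535681,
   76958208867791018356871955754278549126832272911346893908419848040354416723134398596,
   61657109240734297315489262676950953968067117689904781867845477566898737698547236868,
   152128574307930786276994552501357030601539086071549734057161466498929349894135251081,
   136596715008656474076975826426563236305322785035768957856299938617113716422351142913,
   46015784181034580869311487683223319642358806539993091003261053931541591171985965698,
   12049619145384643644149323808430167025122970254806419919564196371779031733993728,
   183666676870306710351639650080952335933865819002340916084123482546794862393096685063,
   474313406970963935669482722628425861712028388431317583104040924183937609642280450,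
   198134159907182093784349596722858633075671503088755624710802759823877450903184425356,
   723490797667141135786810964093140053224351471613877453949060597714631941760796161,
   213677163628805521921566852667898943674202564955433437755475172337288825162549954057,
   121535406270023860551809275497522134492359253445927488797039193719225741205970289413,
   30472779777428888455573220793274248958691382008976241426433189278604106277492850703,
   15545891459137134023109069186979972584126253826740814334727839495547850327492411520,
   121425157494749396622227928873335106074782924515565082102198183392235699164344762497,
   30368154902826439278382912502122802633332085217151313672458277587546156752663758601,
   118578392930623897223215404060613926810321490981442759287211919061991718968624128,
   83853266844045196930091945596478945814907797078170827552028138405888,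
   30368103732274982249107950116282520857628856029062472799759693762248560966115540992,
   137783323108866947459156754221650817697383934939677429118086987610723536495358002307,
   2135206577876621833609855845432532688886826103439790466302516761962915643502166020,
   61895120158854711155130496368410008400239628692750412463236626328317100582613697410,
   46718019439224035301683437168998215935967246343195894805961815411750969786666991619,
   167077845724661061460286640876670000146999082486202111058163462606486321426103025668,
   197776593935617261372881608736463215945674447479000382230576202922314405106889523588,
   197669138931549681438918194799832675361300185929100299913312576972606672957404726785,
   15780196637754377935957799468293497906129907884290169484025974302273254514986321032,
   594751598146939308541421804016207429203321654112860001796461778548147295774507025,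
   212717565692884526522203030710940932241015463833390451481889907761525512517558961796,
   475225944177821052074465347068361709958433491588147228327517073350042415708340237,
   91074748132001255965288418245349591572139759006832397248555249978490999918521680384,
   15178027059439580474448346673800196173036745481423117851207516865648941460046742146,
   62261970869812801143122971075705490474147286634299699506326297705995895646585896962,
   106250893683952148146432972219263391513406304479521270720559787438112669035109990542,
   4718641201313738041830873266944089671222540397287564216493311598215980168332930,
   3770599212909213907133535714070661870830315342666981775133455159455641508053761,
   61069681556348922515298019406755364164059157591464001394808103425650061166793392910,
   60712159002365820693270027927728914427477601443909950728121753022961658278407325326,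
   46011151816356003102449436252574054379026090087836170161170123865912747639642882307,
   136600391069131511530837166522865575297074922903315125969909049242735966998981788808,
   15180828344256728762777479542660170915269729497528493922984583967521872100494229890,
   118600221439505904083783180679122904446695608514024462244304285787174926062486784,
   598471473751384232261738381984418977446047948467892104617105042191977765176131850,
   119512193700328230483373655228497649989099584768561575507413399821878573402276352,
   106252681111655478162490505905070576047073719073805701864275453137664421932839338243,
   16249813113222280994665818202140666151731288275008484886292944065600385911883859200,
   118621818521992480292152813761587631480231528572804593447002086170551499911922056,
   152128573462518515736289693427876654870691824146051099271008577855956644825286099209,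
   4714244006768024966960793578661450770116171913736835155073]

theorem cert1_ok : runs ((2, 7) :: baseE) cert1 = true := by
  decide +kernel


def cert0 : List ℕ :=
  [122249611757601504237554602742797125210625962101917134713851609785194989820634480896,
   45776781447307631085159440700982602247571107347938368499745052295310914638151945473,
   152252702467777571256674395485770882299664834937771091034869547650320366324187988616,
   76128204333559959216790794045087024282415330105213241759707940728003063612222587142,
   10255063094066969596634335511755716681877714230542425943730671480013030168887808,
   31065743890377877845853071536304841356462217381528824927852811452581230118128600454,
   136840313464472593397755448966580858857720745042051267703443207755382218028346310666,
   91181175709600346277117446609382894285701888358786325263528058187397811942549701120,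
   121427082427780625439860108406766218778593572565765419796788643312159641048973476228,
   31660416494041630928131150776113503644456633441675624467771688924057414234464682884,
   152482433976347721354135756079054395219718373840975944557880870340765644728270078219,
   1068999810176187359221362026594101095399051195683986533614244260114573107029722625,
   46005818205112735054924787005076681928734657786650979867916644698087886461711091076,
   239971874167694405468471375439188652280788460015986710370643577328046061585072141,
   60716747436176366464957315578716804670971474841217955753220451250252022310164971524,
   60708634525011392834701440873791851760259807979187269646296341023633439730123720320,
   212717478737109250987221168980520632412022513291798706103182496943446991650009677959,
   227658385587973038444294341872165370882001263349377096573802942141378254316417204744,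
   212953860995057626770631287755380308170778996063373473143032193089964939937841267971,
   167542925222644125874523007049306916950473935725701621596729327899890507047644545039,
   137306274461008089923803048924452155776508881926472340258532913437286591703998808202,
   92726413618559238375923511833336189530804645689955746941482502685351587227348533381,
   227782594090255666793623517914474271891555903564152859657078268759328474543201338242,
   31541837932429066475391084443402502549053106271344282618078212128711514277518884874,
   890352450965696084615495355343911748871195931820732381421000751788916741,
   197433936476470441774325684179732532152607126332140037122731838298242791425422917632,
   198145305176706984300033922266683543187995623752020286000324789760043055212253938052,
   182482775472038955766622885678875355089518290981675437023957954598806260737235747084,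
   1660096828698187829814586238886063587105533704629738928801338558997212984684822534,
   198729895737114401276399038363351396450847544546699766068983869229820707443885212033,
   229325770191615088858299609583593876475223166351309475247373694889804548086473801729,
   32028149840052908611388775581348016886373078499999983217747625955681892111474540800,
   47309912134380496913636826681470365395640098591292319306443748372689996020950729742,
   167907792821782823621118700776132538392206455921680162583860430077923785210146751118,
   16964945057656375892096964169813994035303514703417981505419741089807539510475719938,
   229330430199955310898705636406383398395339469805650534470112459474879989976853086600,
   4335112289661056285457531058108096248284941,
   16134969804087402065612980450600490662867082726767266858174978516171173742646427905,
   46966241721903109918131236349407687965004116448904981283356491856810559348186120448,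
   151778439836064588207603998127602040143112703548396573200192118686278949852787261696,
   15425388077523183168512410942859267271449418882968908774362275058090886902524741262,
   106844704350279336301365414446465266223593062273752245717370258222411515534422050573,
   424553132523798568720992905324675337299231016275891817878164374284,
   151783107592912043719421076512061423792051741765630048854717734703269517655359373312,
   950523183198942221434662573490732668234668522930628008072142219629205017000412930,
   106239712792119912725122171131775429472245436960061327303352478175847111472105719436,
   119519717383850550206574549213952674711195908774358369216748941855245362211618954,
   1315470507332308150016526603259342895975975812558211519594948577670211395968500100,
   182365187752887142691093160339862855377935270250928969610662254349856729489935073795,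
   113965113723621751812065407305978606547100321138270458589736761236199162507,
   3763810537847125097830820358424339298175211629962010829837947351879768732598272,
   182490185936915786315189187082509062874548775411687618556137927025341295368872150276,
   712433110333775237020343942543353206411683766375023183128896887708300856434688004,
   166951871736189891083483081602359673173800482995721191001958737308703989634257059844,
   107668131467222825100981071910028876538981248483306963749124168087599476386851538050,
   30717325659076903405892801838908960458758314365364940944444871542214639539145721344,
   197542288473387147073116387426131985932271241475029981503412907202499886939887404813,
   214026407553657291487708653503752026961231514953301215698467016765163729567887868174,
   1186724573892266217757025348893598553832791822006513519289550581339515920129918594,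
   121419592695508627090689453103593667562330009902761342352213411756971531602059560577,
   118571387413259474958443118219103530818320684536547213909113285691210629654954756,
   445246280390658588082309093299522950458560460348291458011038558988534017,
   30484844544219998653037352628539581729454776631656379647796484074548767718050365440,
   92134390720495181868529836900719494507598481127091319726336249591829500718850507399,
   15189179678616901331383283044278918065305443218755420045302571072156671930420953217,
   76128233450768416143463969153435268513926594088495186417973188114376232491680825742,
   424553133314663568970068267622060774639827832070413252962786968064,
   107318901845878286753525918525292152649385381126784253672414899252225012433883758592,
   91183028944433686290805216843854500730242556823965874964209222050048690189882098188,
   121893898916681089117853906068882788895996224770096008483000076998745944799871944323,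
   198738131330219990209468953050145228911919835287276028860810306266790310842634094215,
   106952057982328583600751545334779906509042424375736174523313145590582903417170182914,
   44101873030498973709020590895757996794713469513672900638200070119280189949582,
   45774929514606282439444550014357267345630954126511430487836199106530411008296584836,
   45661995699351725183794853865741342295137134372634054708941096331036377941784199556,
   15295686350446231769673910025521235762279657948874754754710564629409806241218379904,
   1898071220767933119921782338309681680230449121057617742361852113155964364900024320,
   1551700899046748236781712392401627312471508735235778704280275912540265120471908356,
   15893253251944580830208886945326580359442701924444382962938051640419404274020336140,
   15188289246909597911071221922031832440623222761215075896437820429053420758672376339,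
   151783093683398254090738825575817730127505947617679640335233512187772346407151879810,
   76958208870921123982152923402128546096310169418347637201651465502220384166645597705,
   91310891680083686757191818116720970230902346992378920450902625559752831290841236481,
   30359760201622835169197698326450172297296473887300839225196356578465457047638901899,
   61075326476330823084539357743852549770285700400365831632549415193362099468289394056,
   121424216570925075988464912879548666013247311139727366496321674079904794913529676043,
   122255148068193297666874061757687273323725154580625811280718819368299620278185558020,
   45773076383113247316139583450200578788542440093466806538631088202385660337258037248,
   136721762775269241775297357276222790585935066711658008060319128800210253070997652618,
   168141229727577403999776779866739252541847707679789446320506935508850645350077170310,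
   1313574416726535386045236349221120586239493931994189136931621035313828836774363395,
   15896900648007023715298184996926180734697432807116405001888141541757018813107306887,
   121781789779495567242392520174967631507512732077939559462420114543187208571656866177,
   183201612190887663933979260114130912230459611223936235319424935167708222883020932486,
   76128204447524938351406538580804981399854169994392811643872150183834764874493280642,
   183433197330513243622684804486865707193169696939221832921633767190353857510841188864,
   1433071845752057440608832115402260330694562351882270303197986411761694445735560064,
   167075993729685311326564935470989571812052888847547808404830366569426231932959621511,
   91066396913790734446426133265905603792071717782533377525758377339638713245763666435,
   15187377438965120012378260289301333752947520683706662504584852084597008010594829698,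
   92493802237177810046921649943731122777226575471042023983932470572402560804493246982,
   76359860485867926347461553459270813442162271570789128037507645635088048585397371403,
   152245327903407798667950764510857934152134889665915154689752940412612911401017540619,
   60712144925443244512820615718223499256836863854587016791146192170167197698017493131,
   31065780073196988742678864895260456248094754757575856355334695130602765656749360131,
   152482434763046863938070338757344117495072619484869032390565431226514633071458844681,
   136594833333286476466979561613596186418175043991087286267764715854384136200696956033,
   151774771072205135959727580383283898499103578133859255234762517696139942426663059842,
   168019011742316061096471843564511100003555811997564495794223342321010480354307376521,
   168372821426170702254171550318755042481927376833006809736529819238273673178407616512,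
   246492810610527981571170224972226648669318403806542075526844385769228088759059200,
   1312648529236844207596136126860482993276029549261054714261157116663082510285177733,
   31071193351129189190946918289364558998311522323105036332996859693050189766834897408,
   183668529658590244446756215322979553264923680141690373544263409827694918053467848709,
   1187592620578886798121386756696215191616052377564782978486608926105368717793722755,
   16610165444543198838216126798188116894634192914621168128563915735309784063383093510,
   45649960110294234069110587757570850130927389983236985582619307835750509419673174547,
   1552583871608894173183697795102773462542148612584985597297525467273845136269771648,
   30355193252275800617671337998176167267202277252171240860956696477718115274633445773,
   122485885349168713003564591795089297080033503535878902644334059731764778431032607491,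
   138146541069592913669076583563248880928047644011618872838082594976783726116941677577,
   45772164238149620293474551585716445815511217268496279635339461083187004713409249676,
   122602596592003105212686769473879715884751185387028247962253962176583560764504310788,
   75886437235507587454263418456352555435985747100976510485135978458143146981273403785,
   45768451657408201639818415055304732336962779977433144535477365131600682992808330503,
   46717049399565430872750143516247749693489153109511890815337863076232226070784508043,
   30355128403667195740134897246386836614044927563556029451242708475792689115294778504,
   152128602805876360808282558029887904556772010342227037952744529828785744999199474952,
   2859297439409245809779243534895555927838936931969917376924212821149746838193541,
   168135679227440282939716038843201773624684811740686581779797953298753879056647749760,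
   30721031005921795695649015583259583578725798830535341143946041066903201791250317824,
   106477853412284554071937140600427195121429131273717032237420138692643513355322000776,
   151779395010365924758086875303979423944587242378922317017449557946429522476408111372,
   45540645361928397331033857537790824770719354081289565923072307743877621989507155331,
   168376519592131912837690429123695303548392458064765788432607224592538917289934751108,
   1423823065712655712196662811534723638005935042350203058848094787038095389694804224,
   952339334589678065164683664570490986117247887431540433628373489580165933467582470,
   61665352698044977011983623543067784775651477321417306175322701004849365232048521344,
   481709626219012534012123310512796577660031367373479377573289796083175135920652800,
   1069000031004382783816272711563764611659806711058551942333662871190589587352355204,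
   15296598156606418680235421403732521844646066110040669232298946923078259811452880260,
   91070036953993137144677686051899709308269800130186273173834665941085794243216147073,
   1187570906435773448331604366810178282725216241552663737373884546025151161517999242,
   30483035123197967785975596147834886215422355725745297995698595444826028231998227588,
   151779359276287550629412589368082331464167952249331969682545086312320798577959895687,
   152252753296844800378647364161610745155636424358476101762071766030683726413914243460,
   182725475459171473967541962595986813241469090686603921172492837511478503065084133515,
   152008149634473876774903417883965031275755510921586888851263307141418776977469521924,
   61064188609453689699262579662690008586895047534466449600405000817199896753451565196,
   31433384055497810400135647532640683988804784992539045299845107435098390125781025036,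
   46954242367776716176928304468953701474204295845132412175245762604032207632466068873,
   30472779777429158688610568806205958903902852397636067239680981041605227299305685768,
   46835584485290424266019276303900243105599920913215466422097460744451752006952960128,
   151779359392499396133479083240141655105853890968709424513629596443285446815857508492,
   182480965425104474911115380446327065637417498564773460297387846258822327887871443078,
   31789198896978757802743648743127267731360795444159107633250504007406090877967433997,
   45768531941140837898491938619022163435537581576777035041775543698297278919946176138,
   46967131423923172752349940646717454143585320477924103189027725691376120445597122698,
   76717361835032342947551137042905546369119283725944065497949598940937549070976745860,
   599354389336190179277743258002157379126374009099038824132169292386465932621431296,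
   106249033769978177879090007345015119836887358242380786682802121692115995231514706948,
   15890401927402337807218068193677667643805729968061220998912390001579786211285796229,
   136712535765391223652887509695074848495772453333196092356093078689493286012745515029,
   475268916521098170326654946501268692577973074735743045385526357565038127805988867,
   136714402854966418229305158339021389831471286330656042464395903126131917194726097924,
   16247034438325987398946781378527517904269073025571411080869131909788368217724534791,
   152245327903407771706384101375076747524882678782958571795733122627452749641093775370,
   152606599107894087834112918499556354837674290837355114111696635158277777986062139401,
   62013669212871677098884076452894117199232348947640315302731450567310824849960650120,
   118593097536296624214781104341460306438716937324704777877620133723120344112383235,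
   106951211927642428426682970968128353055673209781568366430557806048304996387733373185,
   349191887671189731387184360284678390577513262288143105201928485226310088547287368705,
   137785190596413607589463450800029970403927149150227006220920663079608473645666566528,
   60832597418366615297348575623495445144026513161312729338184492978925382437051630592,
   603059735729340333982710217274943295185924945311823615166006731327523299734487426,
   16373030368394441710524478539997548197977873216631982973812356283546229768318010378,
   153076216315720102184156473056540165690170948354471268737243499420537996435886505986,
   92012186469395037317529966423059014819802734834594144613363655939271145141863367552,
   62022013759032711079335925836480497154749457643527257807045637749743454748932129035,
   61067843240272088990636252736153292074848248244322806900635286752608993472134775426,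
   168024511474318262441134971634079900702268004484035048163164028150327487041753859336,
   61064195848685162375333953379171496366654967041116380128712472963478061969561486085,
   122844363011168539543808435705904063344614976415658736330685613265765263199145312524,
   238068592011163818008854271653775720755538662776989140714791280119895570876908676,
   183074747370480582501379017482477049641234770620670949895878275368330694755461628033,
   46717085809849036771624902690627248177959228665616728880096887818113397190968770955,
   30472809291712147728263792119433218370057604672533877164135243706893896452250108555,
   136602258333151525672472722542155834783216029502154457277223448857200758011958722569,
   31543639497127581003723547304619705952522754196842917891359835648467551342567817344,
   31543697390980651930297384435897954990093977946119174677106396371206630965606729089,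
   30948996739879421208149429519881017031135372556815626648344477792564850703454028417,
   31658490772972318614232133668817325337106875927256129453954159278070802468009164935,
   15178960631388595595430736382207306180071974936249030613165929577345268302726988812,
   168371004993902989138876722005807499851127243230054536253730986576699253677663191041,
   76717361835032343154961442544539342533257442444638904571212909944361772820197277955,
   153078083065173300630243193509868670531292141086047722017131419685158118063226258816,
   15304942990349608788690232354978553870578844803769988743398510123388984532630766465,
   107310608864268489910152286268739781129637674223901178862350249856545226967157391363,
   603052556146157805613239520226639686970748822316907536242227989775912940486066560,
   121542859930387731572341432427480420834124859691510735754101429648774964885672100610,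
   1544246729430568813415938507852515915255207102490693776495969518934822683913799168,
   31070259778293109903183735523245097048271305292942658372510141051116252488544747917,
   30472787014869601012091627453005663138473791485970019853289968102626235745864581125,
   106955763723201292254778009936063057182558768746132035262158881016489714975028297986,
   61183708266295124741074359224892683339523349556819897349779275363057675613075867275,
   31065722745638998430329688427969525307643975333295504115511165308640464105994502401,
   16490711767071704678112073726464910931771539381161580853258438176914731218994528261,
   121427031879186727372445889363651183223386198966924213677022524082812718297294848516,
   77191660818764685981555337590175959263792624467037868670051034234315217033460991492,
   30481160513901391841710457668542198117748661899297335505265966576763667125530329472,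
   92488265475584229000086067913925067895993031964181820491300511437692599947705369216,
   197779372831359355463970649968838290448745734582296672845183252121472583115095409153,
   167068604295993030558323097059478891283782304677965059962725112350593409897650684034,
   76005999976445514838336509988910615058152641467923171753215938091163162315669389317,
   91070036953979226035922776697905443876528629587756407556993260848492540281854377991,
   121540957273294759576633622811502396589590555660311404317143801809215445780981089803,
   166958312787727663263225449406792791089365519995871654550716975155852615538396104071,
   16137734282336471688252713631048328262342635563999772373464237798528071642650820736,
   15295758669267244091885140777517805164337828353142294810241171935462882197251294091,
   77429764862541415717426435699858817452399710251493191781580626828445937195917869696,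
   91894455201044996604835843969898270926801106458057255678088974331969051017259008000,
   952288676437511143246875266536749312520250698519309065410874254207914100557644041,
   137307258351861342350229891951507022020883116571852480127550120519054159024278814726,
   92130743094762813976934260515882069768724674939422458627392920165816367626735206407,
   152847475715043117052660924718578866733908647204282437098601758526048538739299385477,
   152136917557226235829730996491621509391324535193877629971500215234833558935512811265,
   16246100696335248465989709262698770121499793187165936736533652534265257793073185798,
   137068227185102686948158232347194086586735859992797834228489163199144032102627999761,
   152013787260928238773375034296558306380660316810369338888842147032201488607094030346,
   951376758534870231117921447305177634869436682044024897146645607205671725166526473,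
   15295694158143412706943216945800951642403207571755741149060856110100458322851448321,
   152248070955592244098177349527350601195862354194113241315355852991014240574452547585,
   152255481818455017265768106240587882066856518756231863362087996127677452494263468802,
   30361619940706739622301837761285095465259989350323109836052848459186150461870850818,
   60712173989211507265343318891645407346264192048121992349625662189118666373268078977,
   167190808314787052607657580155668595699852204946567644974444215961982205824428327171,
   1311736214241957013139996804030723680089760821099026836584767023756402532722754048,
   121776304697288762723325433753030928737008670670731679164304048958663147180941050497,
   137307265591958686362887188543625008809456721233091702993526689709496822624854147200,
   152370426726603430998260339434931951792298323792902378748356565421896161803878072327,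
   46961645658860822611925124463734082610458441652229843571991848969835230006947643396,
   168137524776033135385000840742580738730108453451575115857945501714410298423543710338,
   128782627357925635114655178647339289136724376957607107526761445888865737235383168,
   1069000432089074082691758211578668161731013004739113293021392529071899154466210828,
   166951885756963361049593715886063551199506384620682065350017348322172581929642280452,
   167900454551995591815475001534299151900871607747614436183402239988938780732068741125,
   1425661157341545612902134907375817150204547051492575856487591057650874018617622535,
   1424713107875016161355288707151960957543669015497138936524674157793252320731120641,
   106832619175963508636044348621605692239630157111799740193941780145701418573156762756,
   121893898746163118915912060771651879533625980386890103281681511303172573050551010060,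
   167313085270722474056858995475801819853157182523970271468603751894206856470837871883,
   91310023807427915125639495912068129612531064575330670216392909378577834014692016129,
   46966204971919081863427605550009528428579119003170600603101131536629472638647075596,
   167067612712270481637127447335477747986234157328597473945443415510551397973949973764,
   168018953846271441824509945289828018716698282984947215819743549286172242217873244544,
   182374465761912099272357858619466697326832141503071830780973259082169927747890168960,
   121776225205552063452054883725980246960132701188564791345916706036715810693582946308,
   61064159778070839306286996464186329930267804432280317659204272335140649478702448768,
   1073639070883147745312861704188963417267369942400196160782552534717317319139476743,
   91309039008412330455434398235289717837268629139004281489428736427426711457484718600,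
   60713049661599599794459742110657264848007387055945596306462777608197429428888848014,
   30719236624312574847702754972587319640362879610772015590969297185332485195596563721,
   167902235310372091702040326581735939790213643847267423408904245280520964392506901381,
   948626806401470913698142787353167953442071209443959069868670258847183263288606848,
   198261994204079348740411683049594608428021247569891731575449815895646886649095258881,
   30830346319671547722185575755115026134826145747248624837806928538276126178102378755,
   92614254509217149040436207859595753647646755496561253850704650377064674987843126787,
   714285496614739267884785908470448237966620816320236090143261103598098876974925312,
   1551701408333701630835587154685854420308838002109359400614089772559356255157682433,
   212606412980952219608579133930104606143471255195365066525762098368605942786608513421,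
   15427305883990794311943486144683867775277874499506635794153489835456441849772916739,
   167307527254004076230243033246289600327441161521431775790794224886542556318429922308,
   167907793274523525929371468731296225591038724213536992118319159934743507043340124288,
   182718137192486685623189169532798619099207384375866165011460732182784805887709184259,
   475268971282976542550488166660172038493727134458102032965580278114888133241766669,
   91538748633691393410486120166237779751528165089429797801177785415375841054542725640,
   136712535651429453813455273628657879517806199257211496851022300115052507032503533832,
   77079602287599230316810379898323116544734599651157277112264052080064547028497186821,
   77078675951337396172923206733436185097733517844234256611383397015508792621754549254,
   30472809122094830774931700915338278879690127797485676592754969370866229279520212102,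
   122602553565305122196350005734728258611613869465326511768743086576924087876958879755,
   1186703030277337955722740662474059485018249802702206500700592644281245417349349769,
   167195526785881050671861010610211697416629730681599184989208327959586793848672814344,
   31777142100466244769685226839551321141039955400751985071033181603679270870920070536,
   167788310086727003622616751121496807782300025032775040709868603932323293986820359301,
   76243149183844321337504949241817580567564533978389762164155898704612188539039350919,
   61657051794766550137343353103717774830285327540690191979786867050978894461020487948,
   60708482719692566931244968796979637986356128132245529817666082800585418190729855883,
   60708446929996737358625757894610638163470858725495039962843206558904690785764147335,
   62141453019004790641731568890364121499092503157728743425066206622912232148795687687,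
   1068117346897463886612042270466055854493267637834259454025481709416894778637975680,
   60712145041171889443200979855266011606826610707399442792560792748352478808992006411,
   1068999805731651852764185519339728478464664646723072754149268488511179663259910403,
   15301295256846607335797003507722884773242108044334725103178738196119965694605591940,
   126004071271741559274009148356142186885847554291766831531054459805951209005645827,
   1194076977103272111841305172812617671105726768065927503080878956253554889342371212,
   1195922523946666416162010339537927728478924367702825554274803527572462312624308486,
   62132262357612386126406372520308667854430034014821354795518730312125291757790479624,
   958845515222999715618462231320525926374098632739169334384537790424604793865502728,
   30481153280888554387236723076225702790915257329748905190119737787191595674754024075,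
   11181399811416372282298989135551586799670852037099713149125286184031771204682634,
   183196112523375139097674206954193736198917759411459637937627221298843162143105237894,
   152838234567320646169639420206298673540159495016957349704779894514515407727711273347,
   1077329943251555432296197008173070195485420155636606083091166555146248184477516684,
   121428884552614524431456672696609158809800941193816999670950967008834399946848534790,
   30482093806284847826835347003956042881106325592939640619175274653017007084131173892,
   198727941739448902950766941125148312206355973212942048755499805009299948083215533696,
   182129848247901684517904264840999829546076278659144478577996462585787233342863769730,
   61656978971110483571895145033711456159791100615607561110492824589058367277332793091,
   75887363913216202544313862856635397507228021573014653021893524912279844048385164174,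
   213434543187768286039554626318464133402335105712731063006472944147729443159600629517,
   167429803530145010108709031367947029515585749178343946958571348376659985904336667021,
   182374480123728330520275869050128530769896561946632228185382008315095634865033478791,
   16369361209689720552282314905839792565158302065072407208592844321011515411109430795,
   595722086560972363604083336317703046110421815864335529879721631332078270401398274,
   107431972880204263506892980648644562826079548214259367618917706628351006099000836353,
   152841853069218827159609228627661599701343782461188889366583904998178952362864935427,
   152848394982163380803854130787689581669094988861979032480214733940142268943905604736,
   45778634403427695514530601966207701747988648031052275823943784727258630807806297472,
   166958370225744785460775591448252501779628946255352776621270783611026912830059218437,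
   15187319938245791888079031335011404159216609098428268384891507766385023354205717769,
   167543757585186482691632988333241901736132724588742274534566475369113599505313449218,
   1431212050619417391079154785969597244541871264594500654442033775492767118063157888,
   31658556529740261516088191165627973914389059879926138699234294895920150114249884683,
   182846825625655557161899931227950146824520253506203041748230787843903567825383522313,
   15184533351411685664428527925303173984802623585975333826960392275949675349377402113,
   106368517130894762303017030930953916866647325029733971931536957501155948770518631947,
   122848930185388110125234853335256489999341330591599014295017032995373797686921822336,
   91309039006662793137584402851470936238755030320370244978460056263830592840756412928,
   121535471115944075583554680383633035664022030029462417800638857747469554952406337037,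
   92366951666402468915254830150796686883435543934560280768950163377744743485531029644,
   594780657880970391149005301758315825412807674456823580811753636843634152381087873,
   482628724167280986078119997622910858675034372056461254663249144376574335973851264,
   122009711923600071569389012841293148633701414838774126055440489398219376319088608513,
   31307481531138211148424119460804391540956843954569248495029536273170549821824730251,
   830084822857550862608558133286092972588090346474008505636766598745547463911965827,
   107426407512484038025097590189434482498601664267499115017011313592514748421383586443,
   167541058182089178700661721589394768641851218603925847497388942593713231778308883848,
   167782737534599382749313904484277190455436985156570451376790520351322731794560713484,
   91300709215448173888869444541079187252130930590599950707879414747824172169464841862,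
   356647493803986522532221350599627764582980547663130148226391158748026308629906825,
   1196834389313403492829871795115248784799524261072157287360641700097448875298832646,
   76241253087948196761428127182830036834791004879359913941295608496622494287000667017,
   137189555918003038941810855321100051279050011415898735958913025750587208444017672320,
   136951515880021335763376015922047022882825119993891933773428143190833582506206347776,
   30481160229904854491735242072364250672907138304013464536064809901514545790483172225,
   136721762775248402791305023089730203424224585154856371973497190178920910724182115588,
   152009076193382408262816982967188138310653650922897998959966312727992318255756739206,
   107544978612273758056444506764676958094768322023491080616429470552512937298195792384,
   167549315492384972498712282932182294557773229633248175602150423222266521869944407304,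
   136831975647331270380122871103571390290702349310453460069784454642097374095162212872,
   76958208870479383585798612393522851336852363046469187848372100717058061824694600192,
   31072141799533856695503503309650221636447893100408723720717057605366603889957142533,
   258129283348108654015617727917493196440710951779281827206996000241359006456491459980,
   16249857154542437212475794957543332834400612699041487392362614092206538626009432192,
   129767255869480092525102135736350663684160855427318265353876009788564141649199872,
   15192855683864054768291997549526303555198237261680222576504054809483976794831847818,
   183431351218278705999994079910813741904540278203756230054448538594614347999358223746,
   1542408810932204862450071596318866005424908565873996871569852023674655060214858880,
   1074565121778340896905705976169769302261887096663950252959214258178318864329342983,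
   16251666124987379633018739066145278061171006198370357196960299391102635544213062144,
   46599441102839444715884770748274416720176998731449764596608454110795512546896904201,
   122254264930024071015148199084511874462658448732945056247673089098047895893618819076,
   16253525806614357368486385600681447301393569949148281335042538183160142414091389441,
   168138515739592363101091379994348698171744293514632144678012956215570014133656076292,
   483627431813582046250960321822816539185829574266094880777785511031048639615123715,
   15187326835585267060177573922944895286995085718791764117471361994169983619593044098,
   151772940054134989297355398802109846205866726211332586302606693329845528940936955010,
   122846216306526313642062694044171774342398431833980197132403674656708352944434595203,
   484546815987623719306867692536310566292847248360969991655771245987586474330145794,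
   182128986477476842466181719281596071461309420374080237251818235007024151058886803584,
   75888355608711994130552172023886019074345805640906153750729373746116985124928176141,
   77189793669117175221256439256989299921742131279731798785189999585307703253856798216,
   121417739737159351662194057407414801716299970576285558966271713375327163717062345730,
   198490800049973924849655223605309093055124364189362132720914049127552861551305164297,
   31778994269931759632161258224548625606400221686967872629063747199736676980843677186,
   15178960631388595597153271178113885920338766987283660146764108886967857845272313985,
   197306087198032085243201805120702261723105584432384148727920162062549981283372499073,
   151889658196038093564490907092559230918023411714704586579796776669223733337444598156,
   840230939932068035075555944331086414227222570532507126787353913541899370975330315,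
   16487881989240063507618229069126240355193606070620202098338290194260602465707786241,
   1305295448878222747854713920534894606355550186479050764952329408515852550101106689,
   62135055562627230652635330503218389416519152188149495581347424870890614578902941697,
   12057077489967088652071633060231962279936864302681318007440714016256043893588480,
   106713989441555795304981543702572195665040723086816290462485052551763682296091133575,
   15296605450596264724773927715825973728766811299129456329940289509884290470158271621,
   137307273220762548708443600200453261724181637499803997839148912610215297243609563138,
   1546113873311888280158357412085815518864671700133493785911628539466501267111542791,
   601192587403352435113245830220411478464502719318163737962277576886594586869286401,
   16251687834226965858805974413428432047626389453088037362083969306287010142862049410,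
   152484351837577643500719515749222757995164042200104242675696913306044010380931481610,
   830989335921370492011956880267502012095773200643335584710595810397889304429969671,
   15421726156648473448746142637149321136991617494453295514306361265899669698728050950,
   1069035992526250560255340794863327212945866092144951760540002358451280894473896070,
   106248100196238214144413025525175592519790969978264660729586714048229023227643593348,
   122016218048570782588422315979696882856857789373114384746505411248240958657534133507,
   1312669787060754976773708274026363516539382126568721128059752694427026969958842500,
   107314284581526795795041600932848126928253912736296923033170410256299395603966886532,
   137068248891702273492072341229859273316564782246216643019248596158871061238525296770,
   136957066664589939203592488285874462407047802254907786537804320801775883732331266058,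
   60715828106343116400317295573616538147269093930824528133072012885163168978130124938,
   122604449265869163577960233360879704418478885128958280072305876363714574890888594826,
   122722947770833773370111540935047803396824950600921610917785369368770283923203719175,
   1068146408470810594272356665711315549055321801946963231473024113792373567516640775,
   182128075126293552512544013473370476799726537667967561442948561028002795473428743562,
   46835664206320175434541129667454292801485271812533380926092184459647291658327836035,
   60718607116474701995996913785864235551642439699908163419593066223692275120745743116,
   182365129856873584437177173953133631451883658791401623224769948905940452126884890120,
   45534161118026765382779990019511451506133864776496509395385029013624803890582126596,
   122724894524026248528566176708055385582408312891952816675945649109285698190394295816,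
   15295686350446232612055535618572449448905741679414831825178021794134754723578987654,
   212598068316026097290573967137805029602616469045520769173898794638460636816845324288,
   15415213189086336863646611600985397777398612905440117929188579634807109968851977997,
   106239778038700196305243483468342346527489549285156145741840864584205064695177102470,
   107191081798564676604879161928418427537137685431912429341576856713145886063422767243,
   46013005001717276733272729654510577216383121761217272330616181150591632128025362436,
   136951479694993449102064946055872530764340691048895486003116249583434625887829492480,
   477128601684921620824793523658868415081836267334967519712583512735951877826413313,
   76362647130555978821988057420444210444915609190650174094584103520931804526640513281,
   1068138775225622651216273344790304157807743205826690753416749698936454213498061062,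
   166957385992993332832276758596179108538413524483123919697833104022539229705965551617,
   121422363958902358812975638789347241078317829078094768188708206218438498787990226183,
   45775855110559224256668667291540031722640795142234180500104541292669125729118766341,
   76958208869150798047625664033036922253953936294108421081015704953447841381549639050,
   182841347046336221752792055078457312749822005891333259306323963391591316076999213313,
   182599551053242879251218180224166291719821580182431282264615253262566838722931736835,
   15177173149765641827993065458546542453490198404306912767927771506384660314323976331,
   122128269054710808994184925198077325471842715792853919877050250421841103326292361735,
   477128601684921617534088835952337190119090565091365314328622231756995181678706953,
   137779661523728068538227031970145348083859439100333609078697544980938341415966081283,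
   152010929040395892678056543529930528546328448924132820891245822821975534939949564035,
   60713049661599599794459742110557742590937514120144158709173787735204369624889163780,
   183076557134677878201292053757250311530164864069378378150471253413497805007927379209,
   136602315886914362010869686498758208095620078562260261105744712951186295373328090498,
   121893869911674699587240624353377654619780566143847279019249747755444210638340129665,
   16012656437337018624214480258648260856892733140957040451458116869228254204480667778,
   30472845421080819663273952544519002150816917531936493938325642409438846550190211592,
   61064138346171191492528837163421086450856683335298999383058164013677841175510319113,
   1305237944183273466086186832059356708839521817777207509918412095088032771261694216,
   31426950132728736035191458564782762447702171042107797088480744994495991465568813448,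
   167422450332729452397877822130677254619159496600269120419826145866795276999638123137,
   46243669569868372076233810005348192556696106808332602443674493213295027895647944714,
   91655488825458908518229583252206969183483568310048113557400286314680484858343654788,
   76253339567957318186268607718538188902306995600899544274037779042113393717932131591,
   15895055492479113351233591873630374810383065798075031976500204497378893444719673984,
   45769370927599846789155933740013792691984570227106682708528346223319844782629552141,
   950428709910301166254028782698769807735187495778305763666485542468348343461609609,
   152128573686021433824160229590097356166334743926957108383133024112583004707153413252,
   168024511756137244056306401850829237749798681207390383769030255198874308815475621894,
   16253569681426509810689538966702022173441723349507862596895054205878960567290511875,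
   167900382633814217878163134047479907630476412285255316302907471381449475043459350537,
   16251731255856787630606268535692059121044700042336073796383284894836614862703984768,
   720712357764794366702735077698648648573327132585046231482233198233723107786522634,
   15426322103537901718612101397186252263857163347989201525896958044409094909523394688,
   15295686350446232612094510884494908343273529025112970334187329831206468111516598796,
   183672191527742888531628622469681687473823041980725206398897911314671203498214817792,
   60708453600289434930881614089868809127163790251957484937353769450716164113381393805,
   4639432974604403762913717325255769522096643325610780424878677822973532709094152,
   152719620045462848110719389243443903815298387865068859268873492337886082090164831366,
   1308942729185112785002046424995854950084475422485686026840231898737107002040778880,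
   16016383720492806163456246749105652420847568081178778509137069183471053184266485767,
   153080007828591230359209235913224297275091162384392467523123131051615234893897891847,
   106251834491115873495847669011638012528349028476692423997822453553697817986634645507,
   91192364458553706174985749343427058127802010279610227246255001396377507826950471939,
   477071101862902043232873490363672338036559508100005358704906791653777574755091968,
   30472772597390297652401390583660040785166088640803078781096153954644945752020829700,
   60717681062438919392058051145987616171705475565102274630416423136130641940774585741,
   15424461740774667220109257395631868417553566876964277282452947751107896872750024069,
   137306274122656714618909745739429848613785509179475031787088865670663674060771165066,
   31660415929999672264965875790773450249999004800805613353094753500597680052021330053,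
   16128463566414678210485345124381666484250924811367669354337745378149466361498173953,
   151776645287001369818118712867554610038890323305175178103370182638940596626729911808,
   31658490772095688582053824914482533886288638161607557978799182928467363199545556995,
   153078995154898637104434743314150472792455034480780519633004038440862239396645241987,
   153078083291312471187921527759308047593291790649501929492651448637538267192086397568,
   91656386440748956438623135245343551498850689459857984517637181878450689470418273280,
   15181754742330469657393885128632922589209501229308478530846664692077204170816585863,
   30362618418673033073651996575953552850929634486397152232226738341704085828123345669,
   46243669573408831276579550828241969625467736131075705870248490355525584264540242689,
   92134390831830646836498335406957995573219683442878491452270416383084930473767666699,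
   31428773744614273740835852821282021665918385813779648442686181075510720856533762561,
   16249798636536781560329994217738934954086506183226851027163486866299044273548591617,
   45650850767740162630234686217840980606463285040516030226092247314362779726189216266,
   15419815470119069494159164033691854999486128171598472355408261007941659528580449152,
   483606060469639550008204074749773171756719400588476027873949251247748057095307398,
   1076425089178756599638012424689343249816614432853114090566907097943089176494899206,
   31424178302601419942298976825643065726718343158098570770014420700118968679323026186,
   1188518955049637090929761816792683504597117361225180797178671881621554899240190981,
   61777402688700085397377983929142121349962194684756869421574908153099451497011348614,
   60835369420295382943755116680970234309340481116583943370974839168506179265125941377,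
   122486739200988357442470798501647658933465475672274963136458029809891601786209337472,
   1904067990823205263562441261698]

theorem cert0_ok : runs baseE cert0 = true := by
  decide +kernel




theorem core (hx : Ctx G c) {u a b : V} (hab : a ≠ b) (hcyc : ∀ i < 5, G.Adj (c i) (c ((i + 1) % 5)))
    (hu : ∀ i < 5, ¬ G.Adj u (c i)) (hua : G.Adj u a) (hub : G.Adj u b) (ha0 : G.Adj (c 0) a)
    (hb0 : G.Adj (c 0) b) (ha2 : G.Adj (c 2) a) : False := by
  have e0 : G.Adj (c 0) (c 1) := hcyc 0 (by omega)
  have e1 : G.Adj (c 1) (c 2) := hcyc 1 (by omega)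
  have e2 : G.Adj (c 2) (c 3) := hcyc 2 (by omega)
  have e3 : G.Adj (c 3) (c 4) := hcyc 3 (by omega)
  have e4 : G.Adj (c 0) (c 4) := (hcyc 4 (by omega)).symm
  have n1 : ¬ G.Adj (c 0) (c 2) := fun h => hx.tf _ _ _ e0 e1 h
  have n2 : ¬ G.Adj (c 1) (c 3) := fun h => hx.tf _ _ _ e1 e2 h
  have n3 : ¬ G.Adj (c 2) (c 4) := fun h => hx.tf _ _ _ e2 e3 h
  have n4 : ¬ G.Adj (c 0) (c 3) := fun h => hx.tf _ _ _ h e3 e4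
  have n5 : ¬ G.Adj (c 1) (c 4) := fun h => hx.tf _ _ _ e0 h e4
  have u0 : ¬ G.Adj (c 0) u := fun h => hu 0 (by omega) h.symm
  have u1 : ¬ G.Adj (c 1) u := fun h => hu 1 (by omega) h.symm
  have u2 : ¬ G.Adj (c 2) u := fun h => hu 2 (by omega) h.symm
  have u3 : ¬ G.Adj (c 3) u := fun h => hu 3 (by omega) h.symm
  have u4 : ¬ G.Adj (c 4) u := fun h => hu 4 (by omega) h.symm
  have a1 : ¬ G.Adj (c 1) a := fun h => hx.tf _ _ _ e0 h ha0
  have a3 : ¬ G.Adj (c 3) a := fun h => hx.tf _ _ _ e2 h ha2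
  have a4 : ¬ G.Adj (c 4) a := fun h => hx.tf _ _ _ e4 h ha0
  have b1 : ¬ G.Adj (c 1) b := fun h => hx.tf _ _ _ e0 h hb0
  have b4 : ¬ G.Adj (c 4) b := fun h => hx.tf _ _ _ e4 h hb0
  have nab : ¬ G.Adj a b := fun h => hx.tf _ _ _ hua h hub
  by_cases b2 : G.Adj (c 2) b
  · have b3 : ¬ G.Adj (c 3) b := fun h => hx.tf _ _ _ e2 h b2
    refine runs_false hx (root_inv (u := u) hx hab (by decide +kernel) (by decide +kernel) ?_
      (by decide +kernel)) cert1_ok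
    intro i hi j hj hij
    interval_cases j <;> interval_cases i <;>
      first
      | exact iff_of_true (by assumption) (by decide +kernel)
      | exact iff_of_false (by assumption) (by decide +kernel)
  · by_cases b3 : G.Adj (c 3) b
    · refine runs_false hx (root_inv (u := u) hx hab (by decide +kernel) (by decide +kernel) ?_
        (by decide +kernel)) cert2_ok
      intro i hi j hj hij
      interval_cases j <;> interval_cases i <;>
        first
        | exact iff_of_true (by assumption) (by decide +kernel)
        | exact iff_of_false (by assumption) (by decide +kernel)
    · refine runs_false hx (root_inv (u := u) hx hab (by decide +kernel) (by decide +kernel) ?_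
        (by decide +kernel)) cert0_ok
      intro i hi j hj hij
      interval_cases j <;> interval_cases i <;>
        first
        | exact iff_of_true (by assumption) (by decide +kernel)
        | exact iff_of_false (by assumption) (by decide +kernel)

theorem attach [Fintype V] (hG : MinCex G) (c0 : Fin 5 → V) (hc : GoodC5 G c0) {u a b : V}
    (hab : a ≠ b) (hu : ∀ i, ¬ G.Adj u (c0 i)) (hua : G.Adj u a) (hub : G.Adj u b) (k j : Fin 5)
    (hjk : j ≠ k) (hak : G.Adj (c0 k) a) (hbk : G.Adj (c0 k) b) (haj : G.Adj (c0 j) a) : False := by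
  have hcy := hc.1.2
  have red : ∀ (g : ℕ → Fin 5) (_ : ∀ j, ∃ i < 5, g i = j), g 0 = k → g 2 = j →
      (∀ i < 5, g ((i + 1) % 5) = g i + 1 ∨ g i = g ((i + 1) % 5) + 1) → False := by
    intro g hsurj h0 h2 hadj
    have hx : Ctx G (fun i => c0 (g i)) := ctx_of_good hG c0 hc _ (by
      intro x
      constructor
      · rintro ⟨i, _, h⟩; exact ⟨_, h⟩
      · rintro ⟨j, h⟩
        obtain ⟨i, hi, rfl⟩ := hsurj j
        exact ⟨i, hi, h⟩)
    refine core hx hab ?_ (fun i _ => hu _) hua hub ?_ ?_ ?_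
    · intro i hi
      rcases hadj i hi with h | h
      · show G.Adj (c0 (g i)) (c0 (g ((i + 1) % 5)))
        rw [h]; exact hcy _
      · show G.Adj (c0 (g i)) (c0 (g ((i + 1) % 5)))
        rw [h]; exact (hcy _).symm
    · show G.Adj (c0 (g 0)) a
      rw [h0]; exact hak
    · show G.Adj (c0 (g 0)) b
      rw [h0]; exact hbk
    · show G.Adj (c0 (g 2)) a
      rw [h2]; exact haj
  have hx : Ctx G (fun i => c0 (Fin.ofNat 5 i)) := ctx_of_good hG c0 hc _ (by
    intro x
    constructor
    · rintro ⟨i, _, h⟩; exact ⟨_, h⟩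
    · rintro ⟨j, h⟩; exact ⟨j, j.2, by simpa using h⟩)
  have hcases : j = k + 1 ∨ k = j + 1 ∨ j = k + 2 ∨ j = k - 2 := by
    revert hjk; clear * -; revert j k; decide
  rcases hcases with h | h | h | h
  · exact hx.tf _ _ _ (hcy k) (h ▸ haj) hak
  · exact hx.tf _ _ _ (hcy j) (h ▸ hak) haj
  · refine red (fun i => k + Fin.ofNat 5 i) ?_ ?_ h.symm ?_
    · clear * -; revert k; decide
    · clear * -; revert k; decide
    · clear * -; revert k; decide
  · refine red (fun i => k - Fin.ofNat 5 i) ?_ ?_ h.symm ?_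
    · clear * -; revert k; decide
    · clear * -; revert k; decide
    · clear * -; revert k; decide

end

theorem minCex_diamond_one_attachment {V : Type} [Fintype V]
    (G : SimpleGraph V) (hG : MinCex G) (c : Fin 5 → V) (hc : GoodC5 G c)
    (u1 : V) (hu1 : distC G c u1 = 2) (k : Fin 5) (a1 b1 : V) (hab : a1 ≠ b1)
    (ha1 : G.Adj (c k) a1) (ha1u : G.Adj a1 u1)
    (hb1 : G.Adj (c k) b1) (hb1u : G.Adj b1 u1) :
    ∀ y ∈ Set.range c, y ≠ c k → ¬ G.Adj a1 y ∧ ¬ G.Adj b1 y := by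
  rintro y ⟨j, rfl⟩ hj
  have hjk : j ≠ k := fun h => hj (by rw [h])
  have hu : ∀ i, ¬ G.Adj u1 (c i) := by
    have := (two_le_distC hG c u1).1 (by omega)
    intro i h
    exact this ⟨i, Or.inr h⟩
  constructor
  · intro h
    exact attach hG c hc hab hu ha1u.symm hb1u.symm k j hjk ha1 hb1 h.symm
  · intro h
    exact attach hG c hc hab.symm hu hb1u.symm ha1u.symm k j hjk hb1 ha1 h.symm
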